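/- arXiv:2010.03394 — 2 statements merged into one kernel-verified Lean document; each statement's English description precedes it below -/
import Mathlib

section
/- There exists a constant C > 0 with the following property: for every integer n ≥ 2, every N ∈ ℕ, and every matrix A ∈ SL_n(ℂ) with N·ℓ_J(A) ≥ C, every B ∈ SL_n(ℂ) can be written as a product of at most N matrices, each of which is conjugate in SL_n(ℂ) to A or to A⁻¹. -/
open Filter Set Pointwise ENNReal

/-- `CN N g` : the set of all products of at most `N` conjugates of `g` and `g⁻¹`. -/
def CN {H : Type*} [Group H] (N : ℕ) (g : H) : Set H :=
  ⋃ m ≤ N, ({x | IsConj g x} ∪ {x | IsConj g⁻¹ x}) ^ m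

/-- The Jordan length `ℓ_J(A) = (1/n)·min_{λ ≠ 0} rank (A - λ·I_n)` of an `n × n`
complex matrix. -/
noncomputable def jlen (n : ℕ) (A : Matrix (Fin n) (Fin n) ℂ) : ℝ≥0∞ :=
  ((sInf {r : ℕ | ∃ l : ℂ, l ≠ 0 ∧ r = (A - l • (1 : Matrix (Fin n) (Fin n) ℂ)).rank} : ℕ)
    : ℝ≥0∞) / (n : ℝ≥0∞)

open Matrix

theorem exists_units_mulVec_single {K ι J : Type*} [Field K] [Fintype ι] [DecidableEq ι]
    {f : J → ι} (hf : Function.Injective f) {v : J → ι → K} (hv : LinearIndependent K v) :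
    ∃ Q : (Matrix ι ι K)ˣ, ∀ j, (Q : Matrix ι ι K) *ᵥ Pi.single (f j) 1 = v j := by
  classical
  let s := Set.range f
  let e : J ≃ s := Equiv.ofInjective f hf
  let b := Module.Basis.sumExtend hv
  have : Finite J := Finite.of_injective f hf
  have : Fintype J := Fintype.ofFinite J
  have : Finite (J ⊕ Module.Basis.sumExtendIndex hv) := Module.Finite.finite_basis b
  have : Finite (Module.Basis.sumExtendIndex hv) := Finite.of_injective _ (Sum.inr_injective (α := J))
  have : Fintype (Module.Basis.sumExtendIndex hv) := Fintype.ofFinite _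
  have hc : Fintype.card (Module.Basis.sumExtendIndex hv) = Fintype.card (sᶜ : Set ι) := by
    have h1 := Module.finrank_eq_card_basis b
    have h2 := Fintype.card_congr (Equiv.Set.sumCompl s)
    have h3 := Fintype.card_congr e
    simp only [Module.finrank_fintype_fun_eq_card, Fintype.card_sum] at h1 h2
    omega
  let g : J ⊕ Module.Basis.sumExtendIndex hv ≃ ι :=
    (Equiv.sumCongr e (Fintype.equivOfCardEq hc)).trans (Equiv.Set.sumCompl s)
  let b' := b.reindex g
  have hb : ∀ j, b' (f j) = v j := by
    intro j
    have : g (Sum.inl j) = f j := rfl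
    rw [← this]
    simp only [b', Module.Basis.reindex_apply, Equiv.symm_apply_apply]
    simp only [b, Module.Basis.sumExtend, Module.Basis.reindex_apply, Module.Basis.extend_apply_self]
    rfl
  have hinv : IsUnit ((Pi.basisFun K ι).toMatrix b') := by
    have := (Pi.basisFun K ι).invertibleToMatrix b'
    exact isUnit_of_invertible _
  refine ⟨hinv.unit, fun j => ?_⟩
  rw [← hb, IsUnit.unit_spec, Matrix.mulVec_single_one]
  ext i
  simp [Module.Basis.toMatrix]

/-- A perturbation of a diagonal matrix by a matrix supported on `s × sᶜ` is similar to the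
diagonal matrix as soon as no diagonal entry is shared between `s` and `sᶜ`. -/
theorem isConj_diagonal_add {K ι : Type*} [Field K] [Fintype ι] [DecidableEq ι] (s : Set ι)
    (d : ι → K) (X : Matrix ι ι K) (hX : ∀ i j, X i j ≠ 0 → i ∈ s ∧ j ∉ s)
    (hd : ∀ i ∈ s, ∀ j ∉ s, d i ≠ d j) : IsConj (diagonal d + X) (diagonal d) := by
  let Z : Matrix ι ι K := Matrix.of fun i j => X i j / (d j - d i)
  have hZ : ∀ i j, Z i j ≠ 0 → i ∈ s ∧ j ∉ s := fun i j h =>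
    hX i j fun h0 => h (by simp [Z, h0])
  have key : ∀ M : Matrix ι ι K, (∀ i j, M i j ≠ 0 → i ∈ s ∧ j ∉ s) → M * Z = 0 := by
    intro M hM
    ext i j
    rw [Matrix.mul_apply]
    refine Finset.sum_eq_zero fun k _ => ?_
    by_contra h
    exact (hM i k (left_ne_zero_of_mul h)).2 (hZ k j (right_ne_zero_of_mul h)).1
  have hZX : Z * diagonal d = diagonal d * Z + X := by
    ext i j
    simp only [Matrix.mul_diagonal, Matrix.add_apply, Matrix.diagonal_mul, Z, Matrix.of_apply]
    by_cases h : X i j = 0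
    · simp [h]
    · have h1 := hX i j h
      have h2 := sub_ne_zero.2 (hd i h1.1 j h1.2).symm
      field_simp
      ring
  refine IsConj.symm ⟨⟨1 + Z, 1 - Z, ?_, ?_⟩, ?_⟩
  · simp [mul_sub, add_mul, key Z hZ]
  · simp [mul_add, sub_mul, key Z hZ]
  · change (1 + Z) * diagonal d = (diagonal d + X) * (1 + Z)
    simp only [add_mul, mul_add, one_mul, mul_one, key X hX, hZX]
    abel

/-- The commutators of `A` contain, up to similarity, every diagonal matrix made of pairs
`δ⁻¹, δ` attached to a family `v` such that `v` and `A v` are jointly independent. -/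
theorem exists_isConj_commutator_diagonal {K ι T : Type*} [Field K] [Fintype ι] [DecidableEq ι]
    (A : (Matrix ι ι K)ˣ) {v : T → ι → K}
    (hv : LinearIndependent K (Sum.elim v fun i => (A : Matrix ι ι K) *ᵥ v i))
    {f : T ⊕ T → ι} (hf : Function.Injective f) (d : ι → K)
    (h0 : ∀ i, d (f (Sum.inl i)) * d (f (Sum.inr i)) = 1)
    (h1 : ∀ a ∉ Set.range f, d a = 1)
    (h2 : ∀ i, ∀ b ∉ Set.range (f ∘ Sum.inr), d (f (Sum.inr i)) ≠ d b) :
    ∃ g : (Matrix ι ι K)ˣ, IsConj ((A * g * A⁻¹ * g⁻¹ : (Matrix ι ι K)ˣ) : Matrix ι ι K)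
      (diagonal d) := by
  classical
  obtain ⟨Q, hQ⟩ := exists_units_mulVec_single hf hv
  have hd : ∀ a, d a ≠ 0 := by
    intro a ha
    by_cases h : a ∈ Set.range f
    · obtain ⟨i | i, rfl⟩ := h
      · simpa [ha] using h0 i
      · simpa [ha] using h0 i
    · simpa [ha] using h1 a h
  set s : Set ι := Set.range (f ∘ Sum.inr)
  let c : ι → K := fun a => if a ∈ s then 1 else (d a)⁻¹
  have hc : ∀ a, c a ≠ 0 := fun a => by by_cases h : a ∈ s <;> simp [c, h, hd]
  let g : (Matrix ι ι K)ˣ := ⟨diagonal c, diagonal fun a => (c a)⁻¹, by simp [hc], by simp [hc]⟩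
  let A' : (Matrix ι ι K)ˣ := Q⁻¹ * A * Q
  let E : Matrix ι ι K := diagonal fun a => c a - 1
  have hg : (g : Matrix ι ι K) = 1 + E := by
    ext i j
    by_cases h : i = j <;> simp [g, E, h]
  let N : Matrix ι ι K := A' * E * (A'⁻¹ : (Matrix ι ι K)ˣ)
  have hA' : ∀ i, (A' : Matrix ι ι K) *ᵥ Pi.single (f (Sum.inl i)) 1
      = Pi.single (f (Sum.inr i)) 1 := by
    intro i
    have e1 := hQ (Sum.inl i)
    have e2 := hQ (Sum.inr i)
    simp only [Sum.elim_inl, Sum.elim_inr] at e1 e2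
    simp only [A', Units.val_mul, ← Matrix.mulVec_mulVec, e1]
    rw [← e2]
    simp only [Matrix.mulVec_mulVec, Units.inv_mul, Matrix.one_mulVec]
  have hc0 : ∀ a, (∀ i, a ≠ f (Sum.inl i)) → c a = 1 := by
    intro a ha
    by_cases h : a ∈ s
    · simp [c, h]
    · rw [show c a = (d a)⁻¹ by simp [c, h], h1 a, inv_one]
      rintro ⟨i | i, rfl⟩
      · exact ha i rfl
      · exact h ⟨i, rfl⟩
  have hinl : ∀ i, f (Sum.inl i) ∉ s := by
    rintro i ⟨j, hj⟩
    simpa using hf hj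
  have hcinl : ∀ i, c (f (Sum.inl i)) = d (f (Sum.inr i)) := by
    intro i
    simp only [c, hinl, if_false]
    exact inv_eq_of_mul_eq_one_right (h0 i)
  have hAcol : ∀ a i, (A' : Matrix ι ι K) a (f (Sum.inl i)) = if a = f (Sum.inr i) then 1 else 0 := by
    intro a i
    have := congrFun (hA' i) a
    rw [Matrix.mulVec_single_one] at this
    simpa [Pi.single_apply] using this
  have hrow : ∀ a ∉ s, ∀ b, N a b = 0 := by
    intro a ha b
    simp only [N, Matrix.mul_apply (M := _ * E), E, Matrix.mul_diagonal]
    refine Finset.sum_eq_zero fun k _ => ?_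
    by_cases hk : ∃ i, k = f (Sum.inl i)
    · obtain ⟨i, rfl⟩ := hk
      rw [hAcol, if_neg (fun h => ha ⟨i, h.symm⟩)]
      simp
    · rw [hc0 k (by simpa using hk)]
      simp
  have hcol : ∀ i a, N a (f (Sum.inr i))
      = if a = f (Sum.inr i) then d (f (Sum.inr i)) - 1 else 0 := by
    intro i a
    have e : N *ᵥ Pi.single (f (Sum.inr i)) 1
        = (d (f (Sum.inr i)) - 1) • Pi.single (f (Sum.inr i)) (1 : K) := by
      rw [← hA' i]
      simp only [N, ← Matrix.mulVec_mulVec]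
      rw [Matrix.mulVec_mulVec _ ((A'⁻¹ : (Matrix ι ι K)ˣ) : Matrix ι ι K), Units.inv_mul,
        Matrix.one_mulVec]
      have : E *ᵥ Pi.single (f (Sum.inl i)) 1
          = (d (f (Sum.inr i)) - 1) • Pi.single (f (Sum.inl i)) (1 : K) := by
        rw [← hcinl]
        simp [E]
        ext a; by_cases h : a = f (Sum.inl i) <;> simp [h]
      rw [this, Matrix.mulVec_smul]
    have := congrFun e a
    rw [Matrix.mulVec_single_one] at this
    simpa [Pi.single_apply] using this
  let X : Matrix ι ι K := Matrix.of fun a b => if a ∈ s ∧ b ∉ s then N a b * (c b)⁻¹ else 0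
  have hcomm : ((A' * g * A'⁻¹ * g⁻¹ : (Matrix ι ι K)ˣ) : Matrix ι ι K) = diagonal d + X := by
    have : ((A' * g * A'⁻¹ : (Matrix ι ι K)ˣ) : Matrix ι ι K) = 1 + N := by
      simp only [Units.val_mul, hg, N, mul_add, add_mul, mul_one, Units.mul_inv]
    rw [Units.val_mul, this]
    have : ((g⁻¹ : (Matrix ι ι K)ˣ) : Matrix ι ι K) = diagonal fun a => (c a)⁻¹ := rfl
    rw [this]
    ext a b
    rw [Matrix.mul_diagonal]
    simp only [Matrix.add_apply, X, Matrix.of_apply]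
    by_cases ha : a ∈ s
    · by_cases hb : b ∈ s
      · obtain ⟨i, rfl⟩ := hb
        have : c ((f ∘ Sum.inr) i) = 1 := if_pos ⟨i, rfl⟩
        rw [this]
        simp only [Function.comp_apply, hcol]
        by_cases hab : a = f (Sum.inr i)
        · subst hab; simp [s, Matrix.one_apply]
        · simp [hab, s]
      · have hab : a ≠ b := fun h => hb (h ▸ ha)
        simp [ha, hb, hab]
    · rw [hrow a ha]
      by_cases hab : a = b
      · subst hab; simp [ha, c]
      · simp [ha, hab]
  refine ⟨Q * g * Q⁻¹, ?_⟩
  refine IsConj.trans ?_ (isConj_diagonal_add s d X ?_ ?_)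
  · rw [← hcomm]
    have : IsConj (A * (Q * g * Q⁻¹) * A⁻¹ * (Q * g * Q⁻¹)⁻¹) (A' * g * A'⁻¹ * g⁻¹) := by
      refine isConj_iff.2 ⟨Q⁻¹, ?_⟩
      simp only [A']
      group
    exact (Units.coeHom (Matrix ι ι K)).map_isConj this
  · intro i j h
    by_contra h'
    exact h (if_neg h')
  · rintro _ ⟨i, rfl⟩ b hb
    exact h2 i b hb

/-- Two linear maps, one of them surjective onto a space of dimension at least two, that are
pointwise linearly dependent are proportional. -/
theorem exists_eq_smul_of_forall_not_linearIndependent {K V W : Type*} [Field K]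
    [AddCommGroup V] [Module K V] [AddCommGroup W] [Module K W]
    {p q : V →ₗ[K] W} (hp : Function.Surjective p) (hW : 2 ≤ Module.finrank K W)
    (h : ∀ v, ¬ LinearIndependent K ![p v, q v]) : ∃ c : K, q = c • p := by
  have hdep : ∀ v, p v ≠ 0 → ∃ a : K, a • p v = q v := by
    intro v hv
    by_contra hcon
    push Not at hcon
    exact h v ((LinearIndependent.pair_iff' hv).2 hcon)
  have hker : ∀ u, p u = 0 → q u = 0 := by
    intro u hu
    by_contra hq
    have hspan : ∀ w : W, ∃ a : K, a • q u = w := by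
      intro w
      obtain ⟨v, rfl⟩ := hp w
      by_cases hv : p v = 0
      · exact ⟨0, by simp [hv]⟩
      · obtain ⟨a, ha⟩ := hdep v hv
        obtain ⟨b, hb⟩ := hdep (v + u) (by simpa [hu] using hv)
        simp only [map_add, hu, add_zero, ← ha] at hb
        have hb' : (b - a) • p v = q u := by
          rw [sub_smul, hb]; abel
        have hba : b - a ≠ 0 := by
          intro h0; rw [h0, zero_smul] at hb'; exact hq hb'.symm
        exact ⟨(b - a)⁻¹, by rw [← hb', smul_smul, inv_mul_cancel₀ hba, one_smul]⟩
    have := finrank_le_one (q u) hspan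
    omega
  obtain ⟨s, hs⟩ := p.exists_rightInverse_of_surjective (LinearMap.range_eq_top.2 hp)
  have hps : ∀ w, p (s w) = w := fun w => LinearMap.congr_fun hs w
  have hqs : ∀ v, q (s (p v)) = q v := by
    intro v
    have := hker (s (p v) - v) (by simp [hps])
    rwa [map_sub, sub_eq_zero] at this
  obtain ⟨c, hc⟩ := LinearMap.exists_eq_smul_id_of_forall_notLinearIndependent (f := q ∘ₗ s)
    fun w hw => h (s w) (by simpa [hps] using hw)
  refine ⟨c, LinearMap.ext fun v => ?_⟩
  have := LinearMap.congr_fun hc (p v)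
  simpa [hqs] using this

/-- An invertible matrix at rank distance at least `r` from the nonzero scalars moves some
`k`-dimensional subspace to a complementary position, for `2 * k ≤ r + 1`. -/
theorem exists_linearIndependent_sumElim_mulVec {K ι : Type*} [Field K] [Fintype ι]
    [DecidableEq ι] (A : (Matrix ι ι K)ˣ) {r : ℕ}
    (hr : ∀ c : K, c ≠ 0 → r ≤ ((A : Matrix ι ι K) - c • (1 : Matrix ι ι K)).rank) (k : ℕ)
    (hk : 2 * k ≤ r + 1) (hk' : 2 * k ≤ Fintype.card ι) :
    ∃ v : Fin k → ι → K, LinearIndependent K (Sum.elim v fun i => (A : Matrix ι ι K) *ᵥ v i) := by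
  induction k with
  | zero => exact ⟨Fin.elim0, linearIndependent_empty_type⟩
  | succ k ih =>
    obtain ⟨v, hv⟩ := ih (by omega) (by omega)
    set F := Sum.elim v fun i => (A : Matrix ι ι K) *ᵥ v i with hF
    let U := Submodule.span K (Set.range F)
    have hU : Module.finrank K U = 2 * k := by
      rw [finrank_span_eq_card hv]; simp; ring
    have hQ : Module.finrank K ((ι → K) ⧸ U) + 2 * k = Fintype.card ι := by
      rw [← hU, Submodule.finrank_quotient_add_finrank, Module.finrank_fintype_fun_eq_card]
    obtain ⟨w, hw⟩ : ∃ w, LinearIndependent K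
        ![U.mkQ w, (U.mkQ ∘ₗ (A : Matrix ι ι K).mulVecLin) w] := by
      by_contra hcon
      push Not at hcon
      obtain ⟨c, hc⟩ := exists_eq_smul_of_forall_not_linearIndependent U.mkQ_surjective
        (by omega) hcon
      have hmem : ∀ x, ((A : Matrix ι ι K) - c • (1 : Matrix ι ι K)) *ᵥ x ∈ U := by
        intro x
        have := LinearMap.congr_fun hc x
        rw [← Submodule.ker_mkQ U, LinearMap.mem_ker, Matrix.sub_mulVec, Matrix.smul_mulVec,
          Matrix.one_mulVec, map_sub, map_smul, sub_eq_zero]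
        simpa using this
      by_cases h0 : c = 0
      · have htop : U = ⊤ := by
          refine Submodule.eq_top_iff'.2 fun x => ?_
          have := hmem (((A⁻¹ : (Matrix ι ι K)ˣ) : Matrix ι ι K) *ᵥ x)
          simpa [h0, Matrix.mulVec_mulVec] using this
        rw [htop, finrank_top, Module.finrank_fintype_fun_eq_card] at hU
        omega
      · have h1 := hr c h0
        have h2 : ((A : Matrix ι ι K) - c • (1 : Matrix ι ι K)).rank ≤ Module.finrank K U := by
          rw [Matrix.rank]
          refine Submodule.finrank_mono ?_
          rintro _ ⟨x, rfl⟩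
          exact hmem x
        omega
    have hli : LinearIndependent K (Sum.elim F ![w, (A : Matrix ι ι K) *ᵥ w]) := by
      refine LinearIndependent.sumElim_of_quotient (M' := U) (linearIndependent_span hv) _ ?_
      have : Submodule.Quotient.mk (p := U) ∘ ![w, (A : Matrix ι ι K) *ᵥ w]
          = ![U.mkQ w, (U.mkQ ∘ₗ (A : Matrix ι ι K).mulVecLin) w] := by
        funext i; fin_cases i <;> rfl
      rw [this]
      exact hw
    let e : Fin (k + 1) ⊕ Fin (k + 1) → (Fin k ⊕ Fin k) ⊕ Fin 2 :=
      Sum.elim (Fin.cons (Sum.inr 0) fun i => Sum.inl (Sum.inl i))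
        (Fin.cons (Sum.inr 1) fun i => Sum.inl (Sum.inr i))
    have he : Function.Injective e := by
      rintro (i | i) (j | j) <;> refine Fin.cases ?_ (fun i => ?_) i <;>
        refine Fin.cases ?_ (fun j => ?_) j <;> simp [e]
    refine ⟨Fin.cons w v, ?_⟩
    convert hli.comp e he using 1
    ext1 (i | i) <;> refine Fin.cases ?_ (fun i => ?_) i <;> simp [e, hF]

/-- Every nonscalar matrix with determinant `∏ β * ∏ γ` is a product of a conjugate of
`diagonal β` and a conjugate of `diagonal γ` (for `β` and `γ` injective and nonvanishing). -/
def NonscalarFactorization (K ι : Type*) [Field K] [Fintype ι] [DecidableEq ι] : Prop :=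
  ∀ (B : Matrix ι ι K) (β γ : ι → K), Function.Injective β → Function.Injective γ →
    (∀ i, β i ≠ 0) → (∀ i, γ i ≠ 0) → B.det = (∏ i, β i) * ∏ i, γ i →
    (Fintype.card ι ≤ 1 ∨ ∀ c : K, B ≠ c • (1 : Matrix ι ι K)) →
    ∃ X Y : Matrix ι ι K, IsConj X (diagonal β) ∧ IsConj Y (diagonal γ) ∧ B = X * Y

theorem NonscalarFactorization.of_equiv {K ι κ : Type*} [Field K] [Fintype ι] [DecidableEq ι]
    [Fintype κ] [DecidableEq κ] (e : ι ≃ κ) (h : NonscalarFactorization K ι) :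
    NonscalarFactorization K κ := by
  intro B β γ hβ hγ hβ0 hγ0 hdet hB
  obtain ⟨X, Y, hX, hY, hXY⟩ := h (B.submatrix e e) (β ∘ e) (γ ∘ e) (hβ.comp e.injective)
    (hγ.comp e.injective) (fun i => hβ0 _) (fun i => hγ0 _)
    (by rw [Matrix.det_submatrix_equiv_self, hdet]
        simp only [Function.comp_apply, Equiv.prod_comp e])
    (by
      rw [Fintype.card_congr e]
      refine hB.imp_right fun hB c hc => hB c ?_
      have := congrArg (fun M => M.submatrix e.symm e.symm) hc
      rw [Matrix.submatrix_smul, Pi.smul_apply, Pi.smul_apply] at this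
      simpa using this)
  let f := (Matrix.reindexAlgEquiv K K e : Matrix ι ι K ≃ₐ[K] Matrix κ κ K)
  have hfd : ∀ d : κ → K, f (diagonal (d ∘ e)) = diagonal d := by
    intro d
    simp [f, Function.comp_def]
  refine ⟨f X, f Y, ?_, ?_, ?_⟩
  · rw [← hfd]
    exact (f : Matrix ι ι K →* Matrix κ κ K).map_isConj hX
  · rw [← hfd]
    exact (f : Matrix ι ι K →* Matrix κ κ K).map_isConj hY
  · rw [← map_mul, ← hXY]
    simp [f]

theorem isConj_fromBlocks_diagonal {K m n : Type*} [Field K] [Fintype m] [DecidableEq m]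
    [Fintype n] [DecidableEq n] {a : m → K} {b : n → K} {X : Matrix n n K}
    (hX : IsConj X (diagonal b)) (hab : ∀ i j, a i ≠ b j) {P : Matrix m n K} {Q : Matrix n m K}
    (hPQ : P = 0 ∨ Q = 0) :
    IsConj (fromBlocks (diagonal a) P Q X) (diagonal (Sum.elim a b)) := by
  obtain ⟨c, hc⟩ := hX
  have h1 : IsConj (fromBlocks (diagonal a) P Q X)
      (fromBlocks (diagonal a) (P * ((c⁻¹ : (Matrix n n K)ˣ) : Matrix n n K)) ((c : Matrix n n K) * Q)
        (diagonal b)) := by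
    refine ⟨⟨fromBlocks 1 0 0 c, fromBlocks 1 0 0 (c⁻¹ : (Matrix n n K)ˣ), ?_, ?_⟩, ?_⟩
    · simp [Matrix.fromBlocks_multiply]
    · simp [Matrix.fromBlocks_multiply]
    · simp [SemiconjBy, Matrix.fromBlocks_multiply, Matrix.mul_assoc, hc.eq]
  refine h1.trans ?_
  rcases hPQ with rfl | rfl
  · have : fromBlocks (diagonal a) ((0 : Matrix m n K) * ((c⁻¹ : (Matrix n n K)ˣ) : Matrix n n K))
        ((c : Matrix n n K) * Q) (diagonal b)
        = diagonal (Sum.elim a b) + fromBlocks 0 0 ((c : Matrix n n K) * Q) 0 := by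
      rw [← Matrix.fromBlocks_diagonal, Matrix.fromBlocks_add]
      simp
    rw [this]
    refine isConj_diagonal_add (Set.range Sum.inr) _ _ ?_ ?_
    · rintro (i | i) (j | j) <;> simp
    · rintro _ ⟨i, rfl⟩ (j | j) hj
      · exact (hab j i).symm
      · simp at hj
  · have : fromBlocks (diagonal a) (P * ((c⁻¹ : (Matrix n n K)ˣ) : Matrix n n K))
        ((c : Matrix n n K) * (0 : Matrix n m K)) (diagonal b)
        = diagonal (Sum.elim a b) + fromBlocks 0 (P * ((c⁻¹ : (Matrix n n K)ˣ) : Matrix n n K)) 0 0 := by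
      rw [← Matrix.fromBlocks_diagonal, Matrix.fromBlocks_add]
      simp
    rw [this]
    refine isConj_diagonal_add (Set.range Sum.inl) _ _ ?_ ?_
    · rintro (i | i) (j | j) <;> simp
    · rintro _ ⟨i, rfl⟩ (j | j) hj
      · simp at hj
      · exact hab i j

theorem det_eq_of_isConj {K ι : Type*} [Field K] [Fintype ι] [DecidableEq ι]
    {M N : Matrix ι ι K} (h : IsConj M N) : M.det = N.det :=
  isConj_iff_eq.1 (Matrix.detMonoidHom.map_isConj h)

theorem det_fromBlocks_diagonal_const {K n : Type*} [Field K] [Fintype n] [DecidableEq n] {δ : K}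
    (hδ : δ ≠ 0) (y : Matrix Unit n K) (x : Matrix n Unit K) (S : Matrix n n K) :
    (fromBlocks (diagonal fun _ => δ) y x (δ⁻¹ • (x * y) + S)).det = δ * S.det := by
  have hd : (diagonal fun _ => δ : Matrix Unit Unit K) = δ • 1 := by ext; simp
  have : fromBlocks (diagonal fun _ => δ) y x (δ⁻¹ • (x * y) + S)
      = fromBlocks 1 0 (δ⁻¹ • x) S * fromBlocks (diagonal fun _ => δ) y 0 1 := by
    simp [Matrix.fromBlocks_multiply, hd, smul_smul, hδ]
  rw [this, Matrix.det_mul, Matrix.det_fromBlocks_zero₁₂, Matrix.det_fromBlocks_zero₂₁]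
  simp [mul_comm]

/-- The column `e₀` and a nonscalar Schur complement can be reached from any nonscalar matrix. -/
theorem exists_isConj_fromBlocks {K : Type*} [Field K] {n : ℕ} {δ : K} (hδ : δ ≠ 0)
    {B : Matrix (Unit ⊕ Fin (n + 1)) (Unit ⊕ Fin (n + 1)) K} (hdet : B.det ≠ 0)
    (hB : ∀ c : K, B ≠ c • (1 : Matrix _ _ K)) :
    ∃ (y : Matrix Unit (Fin (n + 1)) K) (x : Matrix (Fin (n + 1)) Unit K)
      (S : Matrix (Fin (n + 1)) (Fin (n + 1)) K),
      (n + 1 ≤ 1 ∨ ∀ c : K, S ≠ c • (1 : Matrix _ _ K)) ∧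
      IsConj B (fromBlocks (diagonal fun _ => δ) y x (δ⁻¹ • (x * y) + S)) := by
  obtain ⟨v, hv⟩ : ∃ v, LinearIndependent K ![v, B.mulVecLin v] := by
    by_contra hcon
    push Not at hcon
    obtain ⟨c, hc⟩ := LinearMap.exists_eq_smul_id_of_forall_notLinearIndependent hcon
    refine hB c (Matrix.toLin'.injective ?_)
    rw [map_smul, Matrix.toLin'_one]
    exact hc
  have hv' : LinearIndependent K ![v, B *ᵥ v - δ • v] := by
    rw [LinearIndependent.pair_iff] at hv ⊢
    intro s t h
    obtain ⟨h1, h2⟩ := hv (s - t * δ) t (by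
      rw [← h, Matrix.mulVecLin_apply, smul_sub, smul_smul, sub_smul]; abel)
    subst h2
    exact ⟨by simpa using h1, rfl⟩
  have hf : Function.Injective (![Sum.inl (), Sum.inr 0] : Fin 2 → Unit ⊕ Fin (n + 1)) := by
    intro i j
    fin_cases i <;> fin_cases j <;> simp
  obtain ⟨Q, hQ⟩ := exists_units_mulVec_single hf hv'
  let B' : Matrix (Unit ⊕ Fin (n + 1)) (Unit ⊕ Fin (n + 1)) K := (Q⁻¹ : (Matrix _ _ K)ˣ) * B * Q
  have hconj : IsConj B B' := ⟨Q⁻¹, by simp [SemiconjBy, B', mul_assoc]⟩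
  have hcol : B' *ᵥ Pi.single (Sum.inl ()) 1
      = δ • Pi.single (Sum.inl ()) 1 + Pi.single (Sum.inr 0) 1 := by
    have e0 : Q.1 *ᵥ Pi.single (Sum.inl ()) 1 = v := hQ 0
    have e1 : Q.1 *ᵥ Pi.single (Sum.inr 0) 1 = B *ᵥ v - δ • v := hQ 1
    have : B *ᵥ v = Q.1 *ᵥ
        (δ • Pi.single (Sum.inl ()) 1 + Pi.single (Sum.inr 0) 1) := by
      rw [Matrix.mulVec_add, Matrix.mulVec_smul, e0, e1]; abel
    simp only [B', ← Matrix.mulVec_mulVec, e0]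
    rw [this, Matrix.mulVec_mulVec, Units.inv_mul, Matrix.one_mulVec]
  rw [Matrix.mulVec_single_one] at hcol
  let x : Matrix (Fin (n + 1)) Unit K := Matrix.of fun i _ => if i = 0 then 1 else 0
  let y : Matrix Unit (Fin (n + 1)) K := B'.toBlocks₁₂
  let S : Matrix (Fin (n + 1)) (Fin (n + 1)) K := B'.toBlocks₂₂ - δ⁻¹ • (x * y)
  have hB' : B' = fromBlocks (diagonal fun _ => δ) y x (δ⁻¹ • (x * y) + S) := by
    rw [← Matrix.fromBlocks_toBlocks B']
    congr 1
    · ext ⟨⟩ ⟨⟩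
      simpa using! congrFun hcol (Sum.inl ())
    · ext i ⟨⟩
      simpa [x, Pi.single_apply] using! congrFun hcol (Sum.inr i)
    · simp [S]
  by_cases hS : n + 1 ≤ 1 ∨ ∀ c : K, S ≠ c • (1 : Matrix _ _ K)
  · exact ⟨y, x, S, hS, hB' ▸ hconj⟩
  push Not at hS
  obtain ⟨hn, s, hs⟩ := hS
  have hs0 : s ≠ 0 := by
    rintro rfl
    refine hdet ?_
    rw [det_eq_of_isConj (hB' ▸ hconj), det_fromBlocks_diagonal_const hδ, hs]
    simp [Matrix.det_zero]
  let w : Matrix Unit (Fin (n + 1)) K := Matrix.of fun _ j => if j = 1 then 1 else 0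
  have h01 : (0 : Fin (n + 1)) ≠ 1 := by
    obtain ⟨m, rfl⟩ : ∃ m, n = m + 1 := ⟨n - 1, by omega⟩
    simp
  have hwx : w * x = 0 := by
    ext i j
    simp [w, x, Matrix.mul_apply, h01]
  refine ⟨y + s • w + δ⁻¹ • (w * x * y) - δ • w, x, s • 1 - (s * δ⁻¹) • (x * w), Or.inr ?_, ?_⟩
  · intro c hc
    have := congrFun (congrFun hc 0) 1
    simp [x, w, Matrix.mul_apply, h01, hs0, hδ] at this
  · refine hconj.trans ⟨⟨fromBlocks 1 w 0 1, fromBlocks 1 (-w) 0 1, ?_, ?_⟩, ?_⟩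
    · simp [Matrix.fromBlocks_multiply]
    · simp [Matrix.fromBlocks_multiply]
    · have hd : (diagonal fun _ => δ : Matrix Unit Unit K) = δ • 1 := by ext; simp
      simp only [SemiconjBy, hB', hs, Matrix.fromBlocks_multiply, hd]
      congr 1
      · simp [hwx]
      · simp [hwx, ← Matrix.mul_assoc, Matrix.mul_add]
      · simp
      · simp [hwx, Matrix.mul_add, Matrix.mul_sub, smul_sub, smul_smul, hδ, mul_comm s]
        abel

theorem nonscalarFactorization_fin (K : Type*) [Field K] (n : ℕ) :
    NonscalarFactorization K (Fin n) := by
  induction n with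
  | zero =>
    intro B β γ _ _ _ _ _ _
    exact ⟨1, 1, by rw [Subsingleton.elim (diagonal β) 1],
      by rw [Subsingleton.elim (diagonal γ) 1], Subsingleton.elim _ _⟩
  | succ n ih =>
    refine NonscalarFactorization.of_equiv
      ((Equiv.sumComm _ _).trans (finSumFinEquiv.trans (Equiv.refl _)) :
        Fin 1 ⊕ Fin n ≃ Fin (n + 1)) ?_
    refine NonscalarFactorization.of_equiv
      (Equiv.sumCongr (Equiv.ofUnique Unit (Fin 1)) (Equiv.refl (Fin n))) ?_
    intro B β γ hβ hγ hβ0 hγ0 hdet hB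
    set δ : K := β (Sum.inl ()) * γ (Sum.inl ()) with hδ
    have hδ0 : δ ≠ 0 := mul_ne_zero (hβ0 _) (hγ0 _)
    obtain ⟨y, x, S, hS, hconj⟩ : ∃ (y : Matrix Unit (Fin n) K) (x : Matrix (Fin n) Unit K)
        (S : Matrix (Fin n) (Fin n) K), (n ≤ 1 ∨ ∀ c : K, S ≠ c • (1 : Matrix _ _ K)) ∧
        IsConj B (fromBlocks (diagonal fun _ => δ) y x (δ⁻¹ • (x * y) + S)) := by
      cases n with
      | zero =>
        refine ⟨0, 0, 0, by simp, ?_⟩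
        have : Subsingleton (Unit ⊕ Fin 0) := (Equiv.sumEmpty Unit (Fin 0)).subsingleton
        have hdet' := hdet
        rw [Matrix.det_eq_elem_of_subsingleton B (Sum.inl ())] at hdet'
        convert! IsConj.refl B using 1
        ext (⟨⟩ | i) (⟨⟩ | j)
        · simpa [hδ] using! hdet'.symm
        · exact j.elim0
        · exact i.elim0
        · exact i.elim0
      | succ n =>
        refine exists_isConj_fromBlocks hδ0 ?_ (hB.resolve_left (by simp))
        rw [hdet]
        exact mul_ne_zero (Finset.prod_ne_zero_iff.2 fun i _ => hβ0 i)
          (Finset.prod_ne_zero_iff.2 fun i _ => hγ0 i)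
    have hdS : S.det = (∏ i, β (Sum.inr i)) * ∏ i, γ (Sum.inr i) := by
      have := det_eq_of_isConj hconj
      rw [hdet, det_fromBlocks_diagonal_const hδ0, Fintype.prod_sum_type,
        Fintype.prod_sum_type] at this
      refine mul_left_cancel₀ hδ0 (this.symm.trans ?_)
      simp [hδ]
      ring
    obtain ⟨X, Y, hX, hY, hXY⟩ := ih S (β ∘ Sum.inr) (γ ∘ Sum.inr)
      (hβ.comp Sum.inr_injective) (hγ.comp Sum.inr_injective) (fun _ => hβ0 _) (fun _ => hγ0 _)
      hdS (by simpa using hS)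
    have h1 := isConj_fromBlocks_diagonal (a := β ∘ Sum.inl) hX (P := 0)
      (Q := (γ (Sum.inl ()))⁻¹ • x) (fun i j h => by simpa using hβ h) (Or.inl rfl)
    have h2 := isConj_fromBlocks_diagonal (a := γ ∘ Sum.inl) hY (Q := 0)
      (P := (β (Sum.inl ()))⁻¹ • y) (fun i j h => by simpa using hγ h) (Or.inr rfl)
    rw [Sum.elim_comp_inl_inr] at h1 h2
    obtain ⟨c, hc⟩ := hconj.symm
    refine ⟨c * fromBlocks (diagonal (β ∘ Sum.inl)) 0 ((γ (Sum.inl ()))⁻¹ • x) X *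
        (c⁻¹ : (Matrix _ _ K)ˣ),
      c * fromBlocks (diagonal (γ ∘ Sum.inl)) ((β (Sum.inl ()))⁻¹ • y) 0 Y *
        (c⁻¹ : (Matrix _ _ K)ˣ), IsConj.trans ⟨c⁻¹, ?_⟩ h1, IsConj.trans ⟨c⁻¹, ?_⟩ h2, ?_⟩
    · simp [SemiconjBy, mul_assoc]
    · simp [SemiconjBy, mul_assoc]
    · have : fromBlocks (diagonal fun _ => δ) y x (δ⁻¹ • (x * y) + S)
          = fromBlocks (diagonal (β ∘ Sum.inl)) 0 ((γ (Sum.inl ()))⁻¹ • x) X *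
            fromBlocks (diagonal (γ ∘ Sum.inl)) ((β (Sum.inl ()))⁻¹ • y) 0 Y := by
        have e : ∀ d : Unit ⊕ Fin n → K, (diagonal (d ∘ Sum.inl) : Matrix Unit Unit K)
            = d (Sum.inl ()) • 1 := by
          intro d; ext; simp
        rw [Matrix.fromBlocks_multiply, e, e]
        congr 1
        · ext; simp [δ, mul_comm]
        · simp [smul_smul, hβ0]
        · simp [smul_smul, hγ0]
        · simp [smul_smul, hδ, hXY, mul_comm]
      rw [this] at hc
      rw [(Units.eq_mul_inv_iff_mul_eq c).2 hc.eq.symm]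
      simp [mul_assoc]

/-- Similar matrices of determinant one are conjugate in the special linear group. -/
theorem Matrix.SpecialLinearGroup.isConj_of_isConj_coe {n : ℕ} (hn : n ≠ 0)
    {X Y : SpecialLinearGroup (Fin n) ℂ}
    (h : IsConj (X : Matrix (Fin n) (Fin n) ℂ) (Y : Matrix (Fin n) (Fin n) ℂ)) : IsConj X Y := by
  obtain ⟨c, hc⟩ := h
  have hdet : (c : Matrix (Fin n) (Fin n) ℂ).det ≠ 0 :=
    ((Matrix.isUnit_iff_isUnit_det _).1 c.isUnit).ne_zero
  obtain ⟨z, hz⟩ := IsAlgClosed.exists_pow_nat_eq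
    ((c : Matrix (Fin n) (Fin n) ℂ).det)⁻¹ (Nat.pos_of_ne_zero hn)
  have hs : (z • (c : Matrix (Fin n) (Fin n) ℂ)).det = 1 := by
    rw [Matrix.det_smul, Fintype.card_fin, hz, inv_mul_cancel₀ hdet]
  refine isConj_iff.2 ⟨⟨_, hs⟩, mul_inv_eq_iff_eq_mul.2 (Subtype.ext ?_)⟩
  change z • (c : Matrix (Fin n) (Fin n) ℂ) * X.1 = Y.1 * z • (c : Matrix (Fin n) (Fin n) ℂ)
  rw [Matrix.smul_mul, Matrix.mul_smul, hc.eq]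

theorem isConj_mem_pow {G : Type*} [Group G] {S : Set G}
    (hS : ∀ x ∈ S, ∀ y, IsConj x y → y ∈ S) (k : ℕ) :
    ∀ x ∈ S ^ k, ∀ y, IsConj x y → y ∈ S ^ k := by
  induction k with
  | zero =>
    intro x hx y hxy
    rw [pow_zero, Set.mem_one] at hx ⊢
    rw [hx, isConj_one_right] at hxy
    exact hxy
  | succ k ih =>
    intro x hx y hxy
    obtain ⟨g, rfl⟩ := isConj_iff.1 hxy
    rw [pow_succ] at hx ⊢
    obtain ⟨a, ha, b, hb, rfl⟩ := hx
    exact ⟨g * a * g⁻¹, ih a ha _ (isConj_iff.2 ⟨g, rfl⟩), g * b * g⁻¹,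
      hS b hb _ (isConj_iff.2 ⟨g, rfl⟩), by group⟩

theorem isConj_mem_conj_union {G : Type*} [Group G] (A : G) :
    ∀ x ∈ {x | IsConj A x} ∪ {x | IsConj A⁻¹ x}, ∀ y, IsConj x y →
      y ∈ {x | IsConj A x} ∪ {x | IsConj A⁻¹ x} := by
  rintro x (hx | hx) y hxy
  · exact Or.inl (hx.trans hxy)
  · exact Or.inr (hx.trans hxy)

/-- The diagonal with entries `(i + 2)⁻¹`, `i + 2` in positions `2 * i`, `2 * i + 1`, and a final
`1` when `n` is odd. -/
noncomputable def pairedDiagonal (n : ℕ) (a : Fin n) : ℂ :=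
  if n ≤ 2 * ((a : ℕ) / 2) + 1 then 1
  else if (a : ℕ) % 2 = 0 then (((a : ℕ) / 2 : ℕ) + 2 : ℂ)⁻¹ else (((a : ℕ) / 2 : ℕ) + 2 : ℂ)

theorem pairedDiagonal_ne_zero (n : ℕ) (a : Fin n) : pairedDiagonal n a ≠ 0 := by
  have : (((a : ℕ) / 2 : ℕ) + 2 : ℂ) ≠ 0 := by norm_cast
  unfold pairedDiagonal
  split_ifs <;> simp [this]

theorem natCast_add_two_inj {i j : ℕ} : ((i : ℂ) + 2 = j + 2) ↔ i = j := by
  simp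

theorem natCast_add_two_ne_inv (i j : ℕ) : ((i : ℂ) + 2) ≠ ((j : ℂ) + 2)⁻¹ := by
  intro h
  have h0 : (j : ℂ) + 2 ≠ 0 := by norm_cast
  have h' := mul_inv_cancel₀ h0
  rw [← h] at h'
  norm_cast at h'
  have := Nat.eq_one_of_mul_eq_one_left h'
  omega

theorem natCast_add_two_ne_one (i : ℕ) : ((i : ℂ) + 2) ≠ 1 := by
  norm_cast
  omega

theorem pairedDiagonal_injective (n : ℕ) : Function.Injective (pairedDiagonal n) := by
  intro a b h
  have ha := a.2
  have hb := b.2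
  refine Fin.ext ?_
  unfold pairedDiagonal at h
  split_ifs at h with h1 h2 h3 h4 h5 h6 h7 h8
  · omega
  · exact absurd (inv_eq_one.1 h.symm) (natCast_add_two_ne_one _)
  · exact absurd h.symm (natCast_add_two_ne_one _)
  · exact absurd (inv_eq_one.1 h) (natCast_add_two_ne_one _)
  · rw [_root_.inv_inj, natCast_add_two_inj] at h
    omega
  · exact absurd h.symm (natCast_add_two_ne_inv _ _)
  · exact absurd h (natCast_add_two_ne_one _)
  · exact absurd h (natCast_add_two_ne_inv _ _)
  · rw [natCast_add_two_inj] at h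
    omega

/-- Each block of `k` pairs of the paired diagonal matrix is a product of two conjugates of
`A` and `A⁻¹`. -/
theorem exists_block_mem_sq {n k : ℕ} (hn : n ≠ 0) (hk : 0 < k)
    (A : SpecialLinearGroup (Fin n) ℂ) {v : Fin k → Fin n → ℂ}
    (hv : LinearIndependent ℂ
      (Sum.elim v fun i => (A : Matrix (Fin n) (Fin n) ℂ) *ᵥ v i)) (j : ℕ) :
    ∃ D ∈ ({x | IsConj A x} ∪ {x | IsConj A⁻¹ x}) ^ 2,
      (D : Matrix (Fin n) (Fin n) ℂ) =
        Matrix.diagonal fun a : Fin n => if (a : ℕ) / (2 * k) = j then pairedDiagonal n a else 1 := by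
  let T := {i : Fin (n / 2) // (i : ℕ) / k = j}
  let f : T ⊕ T → Fin n := Sum.elim (fun i => ⟨2 * (i : Fin (n / 2)), by have := i.1.2; omega⟩)
    (fun i => ⟨2 * (i : Fin (n / 2)) + 1, by have := i.1.2; omega⟩)
  have hf : Function.Injective f := by
    rintro (⟨i, hi⟩ | ⟨i, hi⟩) (⟨l, hl⟩ | ⟨l, hl⟩) h <;>
      simp only [f, Sum.elim_inl, Sum.elim_inr, Fin.mk.injEq] at h
    · congr; omega
    · omega
    · omega
    · congr; omega
  let e : T → Fin k := fun i => ⟨(i : Fin (n / 2)) % k, Nat.mod_lt _ hk⟩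
  have he : Function.Injective e := by
    rintro ⟨i, hi⟩ ⟨l, hl⟩ h
    simp only [e, Fin.mk.injEq] at h
    congr
    refine Fin.ext ?_
    rw [← Nat.div_add_mod i k, ← Nat.div_add_mod l k, hi, hl, h]
  have hv' : LinearIndependent ℂ
      (Sum.elim (v ∘ e) fun i => (A : Matrix (Fin n) (Fin n) ℂ) *ᵥ (v ∘ e) i) := by
    convert hv.comp (Sum.map e e) (he.sumMap he) using 1
    ext1 (i | i) <;> rfl
  have hdiv : ∀ a, a / (2 * k) = a / 2 / k := fun a => (Nat.div_div_eq_div_mul a 2 k).symm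
  have hdiv0 : ∀ i, 2 * i / 2 = i := by omega
  have hdiv1 : ∀ i, (2 * i + 1) / 2 = i := by omega
  let d : Fin n → ℂ := fun a => if (a : ℕ) / (2 * k) = j then pairedDiagonal n a else 1
  have hinl : ∀ i : T, d (f (Sum.inl i)) = ((i.1 : ℕ) + 2 : ℂ)⁻¹ := by
    rintro ⟨i, hi⟩
    simp only [d, f, Sum.elim_inl, hdiv, hdiv0, hi, if_true, pairedDiagonal]
    rw [if_neg (by omega), if_pos (by omega)]
  have hinr : ∀ i : T, d (f (Sum.inr i)) = ((i.1 : ℕ) + 2 : ℂ) := by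
    rintro ⟨i, hi⟩
    simp only [d, f, Sum.elim_inr, hdiv, hdiv1, hi, if_true, pairedDiagonal]
    rw [if_neg (by omega), if_neg (by omega)]
  have hrange : ∀ a ∉ Set.range f, d a = 1 := by
    intro a ha
    simp only [d]
    split_ifs with h
    · unfold pairedDiagonal
      rw [if_pos]
      by_contra h'
      have hi : (a : ℕ) / 2 < n / 2 := by omega
      rw [hdiv] at h
      rcases Nat.mod_two_eq_zero_or_one a with h2 | h2
      · refine ha ⟨Sum.inl ⟨⟨a / 2, hi⟩, h⟩, Fin.ext ?_⟩
        simp only [f, Sum.elim_inl]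
        omega
      · refine ha ⟨Sum.inr ⟨⟨a / 2, hi⟩, h⟩, Fin.ext ?_⟩
        simp only [f, Sum.elim_inr]
        omega
    · rfl
  let U : (Matrix (Fin n) (Fin n) ℂ)ˣ := ⟨A, (A⁻¹ : SpecialLinearGroup (Fin n) ℂ),
    congrArg Subtype.val (mul_inv_cancel A),
    congrArg Subtype.val (inv_mul_cancel A)⟩
  obtain ⟨g, hg⟩ := exists_isConj_commutator_diagonal U hv' hf d
    (fun i => by
      rw [hinl, hinr]
      exact inv_mul_cancel₀ (by norm_cast))
    hrange
    (fun i b hb => by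
      rw [hinr]
      by_cases hb' : b ∈ Set.range f
      · obtain ⟨l | l, rfl⟩ := hb'
        · rw [hinl]
          exact natCast_add_two_ne_inv _ _
        · exact absurd ⟨l, rfl⟩ hb
      · rw [hrange b hb']
        exact natCast_add_two_ne_one _)
  have hX : IsConj ((g * U⁻¹ * g⁻¹ : (Matrix (Fin n) (Fin n) ℂ)ˣ) : Matrix (Fin n) (Fin n) ℂ)
      (A⁻¹ : SpecialLinearGroup (Fin n) ℂ) :=
    (Units.coeHom _).map_isConj (isConj_iff.2 ⟨g, rfl⟩ : IsConj U⁻¹ (g * U⁻¹ * g⁻¹)).symm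
  let X : SpecialLinearGroup (Fin n) ℂ := ⟨_, (det_eq_of_isConj hX).trans (A⁻¹).2⟩
  have hAX : IsConj ((A * X : SpecialLinearGroup (Fin n) ℂ) : Matrix (Fin n) (Fin n) ℂ)
      (diagonal d) := by
    have e : U * g * U⁻¹ * g⁻¹ = U * (g * U⁻¹ * g⁻¹) := by group
    rw [e] at hg
    exact hg
  let D : SpecialLinearGroup (Fin n) ℂ := ⟨diagonal d, (det_eq_of_isConj hAX).symm.trans (A * X).2⟩
  refine ⟨D, isConj_mem_pow (isConj_mem_conj_union A) 2 (A * X) ?_ D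
    (SpecialLinearGroup.isConj_of_isConj_coe hn hAX), rfl⟩
  rw [pow_two]
  exact Set.mul_mem_mul (Or.inl (IsConj.refl A))
    (Or.inr (SpecialLinearGroup.isConj_of_isConj_coe (X := X) hn hX).symm)

theorem exists_pairedDiagonal_mem_pow {n k : ℕ} (hn : n ≠ 0) (hk : 0 < k)
    (A : SpecialLinearGroup (Fin n) ℂ) {v : Fin k → Fin n → ℂ}
    (hv : LinearIndependent ℂ
      (Sum.elim v fun i => (A : Matrix (Fin n) (Fin n) ℂ) *ᵥ v i)) (m : ℕ) :
    ∃ D ∈ ({x | IsConj A x} ∪ {x | IsConj A⁻¹ x}) ^ (2 * m),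
      (D : Matrix (Fin n) (Fin n) ℂ) =
        Matrix.diagonal fun a : Fin n => if (a : ℕ) / (2 * k) < m then pairedDiagonal n a else 1 := by
  induction m with
  | zero => exact ⟨1, by simp, by simp⟩
  | succ m ih =>
    obtain ⟨D, hD, hDm⟩ := ih
    obtain ⟨E, hE, hEm⟩ := exists_block_mem_sq hn hk A hv m
    refine ⟨D * E, ?_, ?_⟩
    · rw [mul_add, mul_one, pow_add]
      exact Set.mul_mem_mul hD hE
    · change D.1 * E.1 = _
      rw [hDm, hEm, Matrix.diagonal_mul_diagonal]
      congr 1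
      funext a
      rcases lt_trichotomy ((a : ℕ) / (2 * k)) m with h | h | h
      · rw [if_pos h, if_neg h.ne, if_pos (by omega), mul_one]
      · rw [if_neg (by omega), if_pos h, if_pos (by omega), one_mul]
      · rw [if_neg (by omega), if_neg (by omega), if_neg (by omega), one_mul]

/-- A nonscalar matrix of determinant one is a product of two conjugates of any matrix of
determinant one with distinct eigenvalues. -/
theorem mem_mul_self_of_nonscalar {n : ℕ} (hn : n ≠ 0) {D B : SpecialLinearGroup (Fin n) ℂ}
    {d : Fin n → ℂ} (hd : Function.Injective d) (hd0 : ∀ i, d i ≠ 0)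
    (hD : (D : Matrix (Fin n) (Fin n) ℂ) = diagonal d)
    (hB : ∀ c : ℂ, (B : Matrix (Fin n) (Fin n) ℂ) ≠ c • (1 : Matrix (Fin n) (Fin n) ℂ)) :
    ∃ X Y : SpecialLinearGroup (Fin n) ℂ, IsConj D X ∧ IsConj D Y ∧ B = X * Y := by
  have hdet : (diagonal d).det = 1 := hD ▸ D.2
  have hprod : ∏ i, d i = 1 := by rw [← Matrix.det_diagonal, hdet]
  obtain ⟨X, Y, hX, hY, hXY⟩ := nonscalarFactorization_fin ℂ n B d d hd hd hd0 hd0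
    (by rw [hprod, B.2, mul_one]) (Or.inr hB)
  refine ⟨⟨X, (det_eq_of_isConj hX).trans hdet⟩, ⟨Y, (det_eq_of_isConj hY).trans hdet⟩,
    SpecialLinearGroup.isConj_of_isConj_coe hn (by rw [hD]; exact hX.symm),
    SpecialLinearGroup.isConj_of_isConj_coe hn (by rw [hD]; exact hY.symm), Subtype.ext hXY⟩

/-- Liebeck–Shalev for `SL_n(ℂ)`. There is a constant `C > 0` such that
for all `n ≥ 2`, `N ∈ ℕ` and `A ∈ SL_n(ℂ)` with `N·ℓ_J(A) ≥ C`, every `B ∈ SL_n(ℂ)` is a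
product of at most `N` conjugates of `A` and `A⁻¹`. -/
theorem statement18 : ∃ C : ℝ, 0 < C ∧ ∀ n : ℕ, 2 ≤ n → ∀ N : ℕ,
    ∀ A : Matrix.SpecialLinearGroup (Fin n) ℂ,
      ENNReal.ofReal C ≤ (N : ℝ≥0∞) * jlen n (A : Matrix (Fin n) (Fin n) ℂ) →
      ∀ B : Matrix.SpecialLinearGroup (Fin n) ℂ, B ∈ CN N A := by
  refine ⟨24, by norm_num, fun n hn N A hA B => ?_⟩
  have hn0 : n ≠ 0 := by omega
  unfold jlen at hA
  set r := sInf {r : ℕ | ∃ l : ℂ, l ≠ 0 ∧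
    r = ((A : Matrix (Fin n) (Fin n) ℂ) - l • (1 : Matrix (Fin n) (Fin n) ℂ)).rank}
  have hr : ∀ c : ℂ, c ≠ 0 →
      r ≤ ((A : Matrix (Fin n) (Fin n) ℂ) - c • (1 : Matrix (Fin n) (Fin n) ℂ)).rank :=
    fun c hc => Nat.sInf_le ⟨c, hc, rfl⟩
  have hrn : r ≤ n := by
    simpa using (hr 1 one_ne_zero).trans (Matrix.rank_le_card_width _)
  have hN : 24 * n ≤ N * r := by
    rw [← mul_div_assoc, ENNReal.le_div_iff_mul_le (Or.inl (by simpa using hn0))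
      (Or.inl (ENNReal.natCast_ne_top n)), show ENNReal.ofReal 24 = ((24 : ℕ) : ℝ≥0∞) by simp] at hA
    exact_mod_cast hA
  have hr0 : 0 < r := by
    rcases Nat.eq_zero_or_pos r with h | h
    · rw [h] at hN
      omega
    · exact h
  obtain ⟨k, hk0, hkr, hkn, hrk⟩ : ∃ k, 0 < k ∧ 2 * k ≤ r + 1 ∧ 2 * k ≤ n ∧ r ≤ 4 * k := by
    by_cases h : r = 1
    · exact ⟨1, by omega, by omega, by omega, by omega⟩
    · exact ⟨r / 2, by omega, by omega, by omega, by omega⟩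
  let U : (Matrix (Fin n) (Fin n) ℂ)ˣ := ⟨A, (A⁻¹ : SpecialLinearGroup (Fin n) ℂ),
    congrArg Subtype.val (mul_inv_cancel A),
    congrArg Subtype.val (inv_mul_cancel A)⟩
  obtain ⟨v, hv⟩ := exists_linearIndependent_sumElim_mulVec U hr k hkr (by simpa using hkn)
  let m := n / (2 * k) + 1
  have hm : m * k ≤ n := by
    have := Nat.div_mul_le_self n (2 * k)
    have e : m * k + m * k = n / (2 * k) * (2 * k) + 2 * k := by simp only [m]; ring
    omega
  have hmN : 6 * m ≤ N := by
    refine le_of_mul_le_mul_right ?_ hk0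
    have := Nat.mul_le_mul_left N hrk
    nlinarith
  obtain ⟨D, hD, hDm⟩ := exists_pairedDiagonal_mem_pow hn0 hk0 A hv m
  have hDm' : (D : Matrix (Fin n) (Fin n) ℂ) = diagonal (pairedDiagonal n) := by
    rw [hDm]
    congr 1
    funext a
    exact if_pos (Nat.lt_succ_of_le (Nat.div_le_div_right a.2.le))
  set S := {x | IsConj A x} ∪ {x | IsConj A⁻¹ x}
  have hfact : ∀ B' : SpecialLinearGroup (Fin n) ℂ,
      (∀ c : ℂ, (B' : Matrix (Fin n) (Fin n) ℂ) ≠ c • (1 : Matrix (Fin n) (Fin n) ℂ)) →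
      B' ∈ S ^ (4 * m) := by
    intro B' hB'
    obtain ⟨X, Y, hX, hY, rfl⟩ := mem_mul_self_of_nonscalar hn0 (pairedDiagonal_injective n)
      (pairedDiagonal_ne_zero n) hDm' hB'
    rw [show 4 * m = 2 * m + 2 * m by ring, pow_add]
    exact Set.mul_mem_mul (isConj_mem_pow (isConj_mem_conj_union A) _ D hD X hX)
      (isConj_mem_pow (isConj_mem_conj_union A) _ D hD Y hY)
  unfold CN
  by_cases hB : ∀ c : ℂ, (B : Matrix (Fin n) (Fin n) ℂ) ≠ c • (1 : Matrix (Fin n) (Fin n) ℂ)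
  · exact Set.mem_iUnion₂.2 ⟨4 * m, by omega, hfact B hB⟩
  · push Not at hB
    obtain ⟨b, hb⟩ := hB
    have hDB : ∀ c : ℂ, ((D⁻¹ * B : SpecialLinearGroup (Fin n) ℂ) : Matrix (Fin n) (Fin n) ℂ)
        ≠ c • (1 : Matrix (Fin n) (Fin n) ℂ) := by
      intro c hc
      have h1 : (B : Matrix (Fin n) (Fin n) ℂ) = c • (D : Matrix (Fin n) (Fin n) ℂ) := by
        have h : (B : Matrix (Fin n) (Fin n) ℂ) = (D : Matrix (Fin n) (Fin n) ℂ) *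
            ((D⁻¹ * B : SpecialLinearGroup (Fin n) ℂ) : Matrix (Fin n) (Fin n) ℂ) :=
          congrArg Subtype.val (show B = D * (D⁻¹ * B) by group)
        rw [h, hc, Matrix.mul_smul, Matrix.mul_one]
      rw [hb, hDm'] at h1
      have hdiag : ∀ a, b = c * pairedDiagonal n a := fun a => by
        simpa using congrFun (congrFun h1 a) a
      have hc0 : c ≠ 0 := by
        rintro rfl
        have hb0 : b = 0 := by simpa using hdiag ⟨0, by omega⟩
        have hdet := B.2
        have : Nonempty (Fin n) := ⟨⟨0, by omega⟩⟩
        rw [hb, hb0, zero_smul, Matrix.det_zero] at hdet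
        exact zero_ne_one hdet
      have := pairedDiagonal_injective n (mul_left_cancel₀ hc0
        ((hdiag ⟨0, by omega⟩).symm.trans (hdiag ⟨1, by omega⟩)))
      simp at this
    refine Set.mem_iUnion₂.2 ⟨6 * m, hmN, ?_⟩
    rw [show B = D * (D⁻¹ * B) by group, show 6 * m = 2 * m + 4 * m by ring, pow_add]
    exact Set.mul_mem_mul hD (hfact _ hDB)
end

section
/- Let (m_n)_{n∈ℕ} be a sequence of integers with m_n ≥ 2, and equip each G_n = SL_{m_n}(ℂ) with the Jordan length ℓ_J, a conjugation-invariant pseudo-norm (it satisfies ℓ_J(e) = 0, ℓ_J(gh) ≤ ℓ_J(g) + ℓ_J(h), ℓ_J(g⁻¹) = ℓ_J(g) = ℓ_J(hgh⁻¹), but not necessarily ℓ_J(g) = 0 ⇒ g = e). For any nonprincipal ultrafilter 𝒰 on ℕ, the metric ultraproduct 𝒢*_met = (∏_n G_n)/ℰ, where ℰ = {(g_n) : lim_{n→𝒰} ℓ_J(g_n) = 0}, is a simple group; in fact it is metrically uniformly simple. -/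
open Filter Set Pointwise ENNReal

/-- A family of groups equipped with conjugation-invariant pseudo-norms with values in `[0,∞]`. -/
structure PMFamily where
  G : ℕ → Type
  grp : ∀ n, Group (G n)
  ν : ∀ n, G n → ℝ≥0∞
  norm_one : ∀ n, ν n 1 = 0
  norm_mul : ∀ n (g h : G n), ν n (g * h) ≤ ν n g + ν n h
  norm_inv : ∀ n (g : G n), ν n g⁻¹ = ν n g
  norm_conj : ∀ n (g h : G n), ν n (h * g * h⁻¹) = ν n g

attribute [instance] PMFamily.grp

namespace PMFamily

variable (𝒢 : PMFamily) (U : Ultrafilter ℕ)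

/-- The subgroup of infinitesimal sequences. -/
def E : Subgroup (∀ n, 𝒢.G n) where
  carrier := {g | ∀ ε : ℝ≥0∞, 0 < ε → {n | 𝒢.ν n (g n) < ε} ∈ U}
  one_mem' := by
    intro ε hε
    have h : {n | 𝒢.ν n ((1 : ∀ n, 𝒢.G n) n) < ε} = Set.univ := by
      ext n; simpa [𝒢.norm_one n] using hε
    show {n | 𝒢.ν n ((1 : ∀ n, 𝒢.G n) n) < ε} ∈ U
    rw [h]
    exact Filter.univ_mem
  mul_mem' := by
    intro g h hg hh ε hε
    have h2 : (0 : ℝ≥0∞) < ε / 2 := ENNReal.half_pos hε.ne'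
    have key : {n | 𝒢.ν n (g n) < ε / 2} ∩ {n | 𝒢.ν n (h n) < ε / 2} ⊆
        {n | 𝒢.ν n ((g * h) n) < ε} := by
      rintro n ⟨h1, h1'⟩
      simp only [Set.mem_setOf_eq] at h1 h1' ⊢
      calc 𝒢.ν n ((g * h) n) = 𝒢.ν n (g n * h n) := rfl
        _ ≤ 𝒢.ν n (g n) + 𝒢.ν n (h n) := 𝒢.norm_mul n _ _
        _ < ε / 2 + ε / 2 := ENNReal.add_lt_add h1 h1'
        _ = ε := ENNReal.add_halves ε
    exact Filter.mem_of_superset (Filter.inter_mem (hg _ h2) (hh _ h2)) key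
  inv_mem' := by
    intro g hg ε hε
    have h : {n | 𝒢.ν n (g⁻¹ n) < ε} = {n | 𝒢.ν n (g n) < ε} := by
      ext n; simp only [Set.mem_setOf_eq, Pi.inv_apply, 𝒢.norm_inv n]
    show {n | 𝒢.ν n (g⁻¹ n) < ε} ∈ U
    rw [h]
    exact hg ε hε

theorem mem_E {g : ∀ n, 𝒢.G n} :
    g ∈ 𝒢.E U ↔ ∀ ε : ℝ≥0∞, 0 < ε → {n | 𝒢.ν n (g n) < ε} ∈ U := Iff.rfl

instance normal_E : (𝒢.E U).Normal := by
  constructor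
  intro g hg h
  rw [mem_E] at hg ⊢
  intro ε hε
  have heq : {n | 𝒢.ν n ((h * g * h⁻¹) n) < ε} = {n | 𝒢.ν n (g n) < ε} := by
    ext n
    simp only [Set.mem_setOf_eq, Pi.mul_apply, Pi.inv_apply, 𝒢.norm_conj n]
  rw [heq]
  exact hg ε hε

/-- The metric ultraproduct. -/
abbrev Q := (∀ n, 𝒢.G n) ⧸ 𝒢.E U

/-- The limit of the norms along the ultrafilter, on the product group. -/
noncomputable def pnorm (g : ∀ n, 𝒢.G n) : ℝ≥0∞ :=
  Filter.limsup (fun n => 𝒢.ν n (g n)) U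

/-- The induced norm on the metric ultraproduct. -/
noncomputable def qnorm (x : 𝒢.Q U) : ℝ≥0∞ := 𝒢.pnorm U (Quotient.out x)

/-- The open ball of radius `ε` around the identity in the metric ultraproduct. -/
def ball (ε : ℝ≥0∞) : Set (𝒢.Q U) := {x | 𝒢.qnorm U x < ε}

/-- Metrically internal subsets of the metric ultraproduct. -/
def internalSet (Xn : ∀ n, Set (𝒢.G n)) : Set (𝒢.Q U) :=
  (QuotientGroup.mk : (∀ n, 𝒢.G n) → 𝒢.Q U) '' {g | ∀ n, g n ∈ Xn n}

/-- The finitary subgroup of the metric ultraproduct: classes of uniformly bounded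
sequences (equivalently, elements of finite norm). -/
def finSubgroup : Subgroup (𝒢.Q U) where
  carrier := {x | ∃ g : ∀ n, 𝒢.G n, QuotientGroup.mk g = x ∧
    ∃ C : ℝ≥0∞, C ≠ ⊤ ∧ ∀ n, 𝒢.ν n (g n) ≤ C}
  one_mem' := ⟨1, rfl, 0, by simp, fun n => by simp [𝒢.norm_one n]⟩
  mul_mem' := by
    rintro x y ⟨g, rfl, C, hC, hg⟩ ⟨h, rfl, D, hD, hh⟩
    refine ⟨g * h, rfl, C + D, ENNReal.add_ne_top.mpr ⟨hC, hD⟩, fun n => ?_⟩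
    exact le_trans (𝒢.norm_mul n (g n) (h n)) (add_le_add (hg n) (hh n))
  inv_mem' := by
    rintro x ⟨g, rfl, C, hC, hg⟩
    exact ⟨g⁻¹, rfl, C, hC, fun n => by rw [Pi.inv_apply, 𝒢.norm_inv n]; exact hg n⟩

end PMFamily

section JlenLemmas

variable {k : ℕ}

private lemma matrix_rank_add_le (A B : Matrix (Fin k) (Fin k) ℂ) :
    (A + B).rank ≤ A.rank + B.rank := by
  rw [Matrix.rank, Matrix.rank, Matrix.rank, Matrix.mulVecLin_add]
  refine le_trans (Submodule.finrank_mono ?_)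
    (Submodule.finrank_add_le_finrank_add_finrank _ _)
  rintro x ⟨y, rfl⟩
  exact Submodule.mem_sup.mpr ⟨A.mulVecLin y, ⟨y, rfl⟩, B.mulVecLin y, ⟨y, rfl⟩, rfl⟩

private lemma matrix_rank_smul_le (c : ℂ) (M : Matrix (Fin k) (Fin k) ℂ) :
    (c • M).rank ≤ M.rank := by
  have h : c • M = (c • (1 : Matrix (Fin k) (Fin k) ℂ)) * M := by
    rw [smul_mul_assoc, one_mul]
  rw [h]
  exact Matrix.rank_mul_le_right _ _

private lemma rank_mul_left_of_inv {P Q : Matrix (Fin k) (Fin k) ℂ} (h : Q * P = 1)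
    (M : Matrix (Fin k) (Fin k) ℂ) : (P * M).rank = M.rank := by
  refine le_antisymm (Matrix.rank_mul_le_right _ _) ?_
  have hM : M = Q * (P * M) := by rw [← mul_assoc, h, one_mul]
  calc M.rank = (Q * (P * M)).rank := by rw [← hM]
    _ ≤ (P * M).rank := Matrix.rank_mul_le_right _ _

private lemma rank_mul_right_of_inv {P Q : Matrix (Fin k) (Fin k) ℂ} (h : P * Q = 1)
    (M : Matrix (Fin k) (Fin k) ℂ) : (M * P).rank = M.rank := by
  refine le_antisymm (Matrix.rank_mul_le_left _ _) ?_
  have hM : M = (M * P) * Q := by rw [mul_assoc, h, mul_one]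
  calc M.rank = ((M * P) * Q).rank := by rw [← hM]
    _ ≤ (M * P).rank := Matrix.rank_mul_le_left _ _

private lemma matrix_rank_smul (c : ℂ) (hc : c ≠ 0) (M : Matrix (Fin k) (Fin k) ℂ) :
    (c • M).rank = M.rank := by
  refine le_antisymm (matrix_rank_smul_le c M) ?_
  have h : M = c⁻¹ • (c • M) := by rw [smul_smul, inv_mul_cancel₀ hc, one_smul]
  calc M.rank = (c⁻¹ • (c • M)).rank := by rw [← h]
    _ ≤ (c • M).rank := matrix_rank_smul_le _ _

private lemma jlen_one : jlen k (1 : Matrix (Fin k) (Fin k) ℂ) = 0 := by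
  have h0 : (0 : ℕ) ∈ {r : ℕ | ∃ l : ℂ, l ≠ 0 ∧
      r = ((1 : Matrix (Fin k) (Fin k) ℂ) - l • (1 : Matrix (Fin k) (Fin k) ℂ)).rank} :=
    ⟨1, one_ne_zero, by simp⟩
  have hinf : sInf {r : ℕ | ∃ l : ℂ, l ≠ 0 ∧
      r = ((1 : Matrix (Fin k) (Fin k) ℂ) - l • (1 : Matrix (Fin k) (Fin k) ℂ)).rank} = 0 :=
    Nat.le_zero.mp (Nat.sInf_le h0)
  rw [jlen, hinf]
  simp

private lemma jlen_mul (A B : Matrix (Fin k) (Fin k) ℂ) :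
    jlen k (A * B) ≤ jlen k A + jlen k B := by
  obtain ⟨l, hl, hlrank⟩ := Nat.sInf_mem (s := {r : ℕ | ∃ l : ℂ, l ≠ 0 ∧
    r = (A - l • (1 : Matrix (Fin k) (Fin k) ℂ)).rank}) ⟨_, 1, one_ne_zero, rfl⟩
  obtain ⟨m, hm, hmrank⟩ := Nat.sInf_mem (s := {r : ℕ | ∃ l : ℂ, l ≠ 0 ∧
    r = (B - l • (1 : Matrix (Fin k) (Fin k) ℂ)).rank}) ⟨_, 1, one_ne_zero, rfl⟩
  have hid : A * B - (l * m) • (1 : Matrix (Fin k) (Fin k) ℂ) =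
      (A - l • 1) * B + l • (B - m • 1) := by
    have h1 : (A - l • (1 : Matrix (Fin k) (Fin k) ℂ)) * B = A * B - l • B := by
      rw [sub_mul, smul_mul_assoc, one_mul]
    have h2 : l • (B - m • (1 : Matrix (Fin k) (Fin k) ℂ)) = l • B - (l * m) • 1 := by
      rw [smul_sub, smul_smul]
    rw [h1, h2, sub_add_sub_cancel]
  have hrank : (A * B - (l * m) • (1 : Matrix (Fin k) (Fin k) ℂ)).rank ≤
      (A - l • (1 : Matrix (Fin k) (Fin k) ℂ)).rank +
      (B - m • (1 : Matrix (Fin k) (Fin k) ℂ)).rank := by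
    rw [hid]
    refine le_trans (matrix_rank_add_le _ _) (add_le_add ?_ ?_)
    · exact Matrix.rank_mul_le_left _ _
    · exact matrix_rank_smul_le _ _
  have hinf : sInf {r : ℕ | ∃ l : ℂ, l ≠ 0 ∧
      r = (A * B - l • (1 : Matrix (Fin k) (Fin k) ℂ)).rank} ≤
      (A - l • (1 : Matrix (Fin k) (Fin k) ℂ)).rank +
      (B - m • (1 : Matrix (Fin k) (Fin k) ℂ)).rank :=
    le_trans (Nat.sInf_le ⟨l * m, mul_ne_zero hl hm, rfl⟩) hrank
  rw [jlen, jlen, jlen, ← ENNReal.add_div, hlrank, hmrank]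
  refine ENNReal.div_le_div_right ?_ _
  exact_mod_cast hinf

private lemma rank_sub_smul_of_inv {A B : Matrix (Fin k) (Fin k) ℂ}
    (hAB : A * B = 1) (hBA : B * A = 1) (l : ℂ) (hl : l ≠ 0) :
    (B - l • (1 : Matrix (Fin k) (Fin k) ℂ)).rank =
      (A - l⁻¹ • (1 : Matrix (Fin k) (Fin k) ℂ)).rank := by
  have h1 : B - l • (1 : Matrix (Fin k) (Fin k) ℂ) = B * (1 - l • A) := by
    rw [mul_sub, mul_one, mul_smul_comm, hBA]
  have h2 : (1 : Matrix (Fin k) (Fin k) ℂ) - l • A =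
      (-l) • (A - l⁻¹ • (1 : Matrix (Fin k) (Fin k) ℂ)) := by
    rw [smul_sub, smul_smul, neg_mul, mul_inv_cancel₀ hl, neg_smul, neg_smul, sub_neg_eq_add,
      one_smul, neg_add_eq_sub]
  rw [h1, h2, rank_mul_left_of_inv (Q := A) hAB, matrix_rank_smul _ (neg_ne_zero.mpr hl)]

private lemma jlen_inv {A B : Matrix (Fin k) (Fin k) ℂ} (hAB : A * B = 1) (hBA : B * A = 1) :
    jlen k B = jlen k A := by
  have hset : {r : ℕ | ∃ l : ℂ, l ≠ 0 ∧
      r = (B - l • (1 : Matrix (Fin k) (Fin k) ℂ)).rank} =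
      {r : ℕ | ∃ l : ℂ, l ≠ 0 ∧ r = (A - l • (1 : Matrix (Fin k) (Fin k) ℂ)).rank} := by
    ext r
    constructor
    · rintro ⟨l, hl, rfl⟩
      exact ⟨l⁻¹, inv_ne_zero hl, rank_sub_smul_of_inv hAB hBA l hl⟩
    · rintro ⟨l, hl, rfl⟩
      exact ⟨l⁻¹, inv_ne_zero hl, rank_sub_smul_of_inv hBA hAB l hl⟩
  rw [jlen, jlen, hset]

private lemma jlen_conj {A H Hi : Matrix (Fin k) (Fin k) ℂ}
    (h1 : H * Hi = 1) (h2 : Hi * H = 1) :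
    jlen k (H * A * Hi) = jlen k A := by
  have key : ∀ l : ℂ, (H * A * Hi - l • (1 : Matrix (Fin k) (Fin k) ℂ)).rank =
      (A - l • (1 : Matrix (Fin k) (Fin k) ℂ)).rank := by
    intro l
    have hid : H * (A - l • (1 : Matrix (Fin k) (Fin k) ℂ)) * Hi =
        H * A * Hi - l • (1 : Matrix (Fin k) (Fin k) ℂ) := by
      rw [mul_sub, mul_smul_comm, mul_one, sub_mul, smul_mul_assoc, h1]
    rw [← hid, rank_mul_right_of_inv h2, rank_mul_left_of_inv h2]
  have hset : {r : ℕ | ∃ l : ℂ, l ≠ 0 ∧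
      r = (H * A * Hi - l • (1 : Matrix (Fin k) (Fin k) ℂ)).rank} =
      {r : ℕ | ∃ l : ℂ, l ≠ 0 ∧ r = (A - l • (1 : Matrix (Fin k) (Fin k) ℂ)).rank} := by
    ext r
    simp_rw [key]
  rw [jlen, jlen, hset]

end JlenLemmas

/-- The family `(SL_{m_n}(ℂ), ℓ_J)_{n∈ℕ}` with the Jordan length as conjugation-invariant
pseudo-norm. -/
noncomputable def SLFamily (m : ℕ → ℕ) : PMFamily where
  G := fun n => Matrix.SpecialLinearGroup (Fin (m n)) ℂ
  grp := fun _ => inferInstance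
  ν := fun n A => jlen (m n) (A : Matrix (Fin (m n)) (Fin (m n)) ℂ)
  norm_one := fun n => by
    simp only [Matrix.SpecialLinearGroup.coe_one]
    exact jlen_one
  norm_mul := fun n g h => by
    simp only [Matrix.SpecialLinearGroup.coe_mul]
    exact jlen_mul _ _
  norm_inv := fun n g => by
    refine jlen_inv (A := (g : Matrix (Fin (m n)) (Fin (m n)) ℂ)) ?_ ?_
    · rw [← Matrix.SpecialLinearGroup.coe_mul, mul_inv_cancel, Matrix.SpecialLinearGroup.coe_one]
    · rw [← Matrix.SpecialLinearGroup.coe_mul, inv_mul_cancel, Matrix.SpecialLinearGroup.coe_one]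
  norm_conj := fun n g h => by
    have hco : ((h * g * h⁻¹ : Matrix.SpecialLinearGroup (Fin (m n)) ℂ) :
        Matrix (Fin (m n)) (Fin (m n)) ℂ) =
        (h : Matrix (Fin (m n)) (Fin (m n)) ℂ) * (g : Matrix (Fin (m n)) (Fin (m n)) ℂ) *
          (h⁻¹ : Matrix.SpecialLinearGroup (Fin (m n)) ℂ) := by
      simp only [Matrix.SpecialLinearGroup.coe_mul]
    show jlen (m n) ((h * g * h⁻¹ : Matrix.SpecialLinearGroup (Fin (m n)) ℂ) :
        Matrix (Fin (m n)) (Fin (m n)) ℂ) = _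
    rw [hco]
    refine jlen_conj ?_ ?_
    · rw [← Matrix.SpecialLinearGroup.coe_mul, mul_inv_cancel, Matrix.SpecialLinearGroup.coe_one]
    · rw [← Matrix.SpecialLinearGroup.coe_mul, inv_mul_cancel, Matrix.SpecialLinearGroup.coe_one]

section LinearAlgebra

variable {K V : Type*} [Field K] [AddCommGroup V] [Module K V]

/-- If every `f - a` has rank larger than `2 dim U`, then some `v` is linearly independent of
`f v` modulo `U`. -/
theorem exists_linearIndependent_pair_mkQ [FiniteDimensional K V] (f : Module.End K V) (U : Submodule K V)
    (h : ∀ a : K, 2 * Module.finrank K U < Module.finrank K (LinearMap.range (f - a • 1))) :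
    ∃ v, LinearIndependent K ![U.mkQ v, U.mkQ (f v)] := by
  by_contra! hdep
  obtain ⟨s, hs⟩ := U.mkQ.exists_rightInverse_of_surjective U.range_mkQ
  have hs' : ∀ q, U.mkQ (s q) = q := fun q => LinearMap.congr_fun hs q
  obtain ⟨a, ha⟩ := LinearMap.exists_eq_smul_id_of_forall_notLinearIndependent
    (f := U.mkQ ∘ₗ f ∘ₗ s) (fun q => by simpa [hs'] using hdep (s q))
  have hmem : ∀ {x}, U.mkQ x = 0 → x ∈ U := fun h => (Submodule.Quotient.mk_eq_zero U).1 h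
  have hle : LinearMap.range (f - a • 1) ≤ U ⊔ U.map (f - a • 1) := by
    rintro _ ⟨v, rfl⟩
    have hU : v - s (U.mkQ v) ∈ U := by
      apply hmem
      rw [map_sub, hs', sub_self]
    have hs2 : (f - a • 1) (s (U.mkQ v)) ∈ U := by
      have := LinearMap.congr_fun ha (U.mkQ v)
      apply hmem
      simp only [LinearMap.comp_apply, LinearMap.smul_apply, Module.End.one_apply] at this
      simp only [LinearMap.sub_apply, LinearMap.smul_apply, Module.End.one_apply, map_sub,
        map_smul, this, hs', sub_self]
    have : (f - a • 1) v = (f - a • 1) (s (U.mkQ v)) + (f - a • 1) (v - s (U.mkQ v)) := by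
      rw [← map_add, add_sub_cancel]
    rw [this]
    exact Submodule.add_mem_sup hs2 (Submodule.mem_map_of_mem hU)
  have h1 := Submodule.finrank_mono hle
  have h2 := Submodule.finrank_add_le_finrank_add_finrank U (U.map (f - a • 1))
  have h3 := Submodule.finrank_map_le (f - a • 1) U
  have := h a
  omega

theorem LinearIndepOn.exists_extend_finset {ι : Type*} [Fintype ι] {w : ι → V} {S : Finset ι}
    (hw : LinearIndepOn K w (S : Set ι)) (hcard : Fintype.card ι ≤ Module.finrank K V) :
    ∃ w' : ι → V, LinearIndependent K w' ∧ ∀ i ∈ S, w' i = w i := by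
  classical
  induction hn : Fintype.card ι - S.card generalizing w S with
  | zero =>
    have : S = Finset.univ := by
      rw [← Finset.card_eq_iff_eq_univ]
      exact le_antisymm S.card_le_univ (by omega)
    subst this
    exact ⟨w, by simpa using hw, fun _ _ => rfl⟩
  | succ k ih =>
    obtain ⟨a, ha⟩ : ∃ a, a ∉ S := by
      by_contra! hall
      have : S = Finset.univ := Finset.eq_univ_of_forall hall
      simp [this] at hn
    have hlt : Submodule.span K (w '' S) ≠ ⊤ := by
      intro htop
      have h1 : Module.finrank K (Submodule.span K (w '' (S : Set ι))) ≤ S.card := by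
        rw [← Finset.coe_image]
        exact (finrank_span_finset_le_card _).trans Finset.card_image_le
      rw [htop, finrank_top] at h1
      omega
    obtain ⟨v, -, hv⟩ := SetLike.exists_of_lt hlt.lt_top
    have heq : ∀ i ∈ S, Function.update w a v i = w i := fun i hi =>
      Function.update_of_ne (fun h => ha (by rwa [← h])) _ _
    have himg : Function.update w a v '' S = w '' S := Set.image_congr heq
    obtain ⟨w', hw', hS⟩ := ih (w := Function.update w a v) (S := insert a S) (by
        rw [Finset.coe_insert]
        refine LinearIndepOn.insert ((linearIndepOn_congr heq).2 hw) ?_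
        rwa [himg, Function.update_self])
      (by rw [Finset.card_insert_of_notMem ha]; omega)
    exact ⟨w', hw', fun i hi => by rw [hS i (Finset.mem_insert_of_mem hi), heq i hi]⟩

theorem exists_linearIndepOn_map_eq [FiniteDimensional K V] {ι : Type*} [DecidableEq ι] (f : Module.End K V) (σ : Equiv.Perm ι) (I : Finset ι)
    (hσ : Disjoint I (I.image σ))
    (hrank : ∀ a : K, 4 * I.card < Module.finrank K (LinearMap.range (f - a • 1)) + 4) :
    ∃ w : ι → V, LinearIndepOn K w ((I ∪ I.image σ : Finset ι) : Set ι) ∧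
      ∀ i ∈ I, w (σ i) = f (w i) := by
  classical
  induction I using Finset.induction_on with
  | empty => exact ⟨0, by simp, by simp⟩
  | insert a I ha ih =>
    rw [Finset.card_insert_of_notMem ha] at hrank
    rw [Finset.image_insert] at hσ
    have haS : a ∉ I ∪ I.image σ := by
      rw [Finset.disjoint_left] at hσ
      have := @hσ a (Finset.mem_insert_self _ _)
      simp only [Finset.mem_union, Finset.mem_insert] at this ⊢
      tauto
    have hsaS : σ a ∉ insert a (I ∪ I.image σ) := by
      rw [Finset.disjoint_right] at hσ
      have := @hσ (σ a) (Finset.mem_insert_self _ _)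
      simp only [Finset.mem_insert, Finset.mem_union, Finset.mem_image,
        EmbeddingLike.apply_eq_iff_eq] at this ⊢
      rintro (h | h | ⟨x, hx, rfl⟩)
      · exact this (.inl h)
      · exact this (.inr h)
      · exact ha hx
    obtain ⟨w, hw, hwf⟩ := ih (hσ.mono (Finset.subset_insert _ _) (Finset.subset_insert _ _))
      (fun c => by have := hrank c; omega)
    set S := I ∪ I.image σ with hS
    set U := Submodule.span K (w '' (S : Set ι)) with hU
    have hUc : Module.finrank K U ≤ 2 * I.card := by
      rw [hU, ← Finset.coe_image]
      refine (finrank_span_finset_le_card _).trans (Finset.card_image_le.trans ?_)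
      refine (Finset.card_union_le _ _).trans ?_
      have : (I.image σ).card ≤ I.card := Finset.card_image_le
      omega
    obtain ⟨v, hv⟩ := exists_linearIndependent_pair_mkQ f U
      (fun c => by have := hrank c; omega)
    rw [LinearIndependent.pair_iff] at hv
    have hvU : v ∉ U := fun h => by
      have := hv 1 0 (by simpa using h)
      simp at this
    have hfv : f v ∉ Submodule.span K (insert v (w '' (S : Set ι))) := by
      rw [Submodule.mem_span_insert]
      rintro ⟨c, z, hz, hzv⟩
      have := hv (-c) 1 (by
        rw [hzv, map_add, map_smul, (by simpa using hz : U.mkQ z = 0)]; simp)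
      simp at this
    let w' := Function.update (Function.update w a v) (σ a) (f v)
    have hne : σ a ≠ a := fun h => hsaS (by simp [h])
    have hw'S : ∀ i ∈ S, w' i = w i := fun i hi => by
      have h1 : i ≠ σ a := fun h => hsaS (by simp [← h, hi])
      have h2 : i ≠ a := fun h => haS (by simpa [← h] using hi)
      simp [w', h1, h2]
    have hw'a : w' a = v := by simp [w', hne.symm]
    have hw'sa : w' (σ a) = f v := by simp [w']
    have himg : w' '' S = w '' S := Set.image_congr hw'S
    refine ⟨w', ?_, ?_⟩
    · have : insert a I ∪ (insert a I).image σ = insert (σ a) (insert a S) := by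
        rw [Finset.image_insert, hS]; ext; simp
      rw [this, Finset.coe_insert, Finset.coe_insert]
      refine ((linearIndepOn_congr hw'S).2 hw |>.insert ?_).insert ?_
      · rwa [himg, hw'a]
      · rwa [Set.image_insert_eq, himg, hw'a, hw'sa]
    · intro i hi
      rcases Finset.mem_insert.1 hi with rfl | hi
      · rw [hw'sa, hw'a]
      · rw [hw'S _ (by simp [hS, hi]), hw'S _ (by simp [hS, hi]), hwf i hi]

/-- Over an algebraically closed field every endomorphism is triangular in some basis. -/
theorem exists_basis_forall_repr_eq_zero [IsAlgClosed K] [FiniteDimensional K V] (n : ℕ) (hn : Module.finrank K V = n)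
    (f : Module.End K V) :
    ∃ b : Module.Basis (Fin n) K V, ∀ i j, i < j → b.repr (f (b j)) i = 0 := by
  suffices h : ∃ b : Module.Basis (Fin n) K V, ∀ j, f (b j) ∈ Submodule.span K (b '' Ici j) by
    obtain ⟨b, hb⟩ := h
    refine ⟨b, fun i j hij => ?_⟩
    by_contra hne
    exact absurd (b.mem_span_image.1 (hb j) (Finsupp.mem_support_iff.2 hne)) (by simpa using hij)
  induction n generalizing V with
  | zero => exact ⟨Module.finBasisOfFinrankEq K V hn, fun j => j.elim0⟩
  | succ n ih =>
    have : Nontrivial V := Module.nontrivial_of_finrank_pos (R := K) (by omega)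
    obtain ⟨a, ha⟩ := Module.End.exists_eigenvalue f
    have hrange : LinearMap.range (f - a • 1) < ⊤ := by
      rw [lt_top_iff_ne_top, Ne, LinearMap.range_eq_top, ← LinearMap.injective_iff_surjective,
        ← LinearMap.ker_eq_bot]
      obtain ⟨v, hv⟩ := ha.exists_hasEigenvector
      intro hbot
      refine hv.2 ((Submodule.mem_bot K).1 (hbot ▸ ?_))
      simp [hv.apply_eq_smul]
    obtain ⟨φ, hφ, hle⟩ := Submodule.exists_le_ker_of_lt_top _ hrange
    have hmem : ∀ x, f x - a • x ∈ LinearMap.ker φ := fun x => hle ⟨x, by simp⟩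
    have hinv : ∀ x ∈ LinearMap.ker φ, f x ∈ LinearMap.ker φ := fun x hx => by
      have := add_mem (hmem x) (Submodule.smul_mem _ a hx)
      simpa using this
    have hdim : Module.finrank K (LinearMap.ker φ) = n := by
      have h1 := φ.finrank_range_add_finrank_ker
      rw [LinearMap.range_eq_top.2 (LinearMap.surjective hφ), finrank_top,
        Module.finrank_self] at h1
      omega
    obtain ⟨b, hb⟩ := ih hdim (f.restrict hinv)
    obtain ⟨y, hy⟩ : ∃ y, φ y ≠ 0 := by
      by_contra! h
      exact hφ (LinearMap.ext h)
    let b' := Module.Basis.mkFinCons y b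
      (fun c x hx hcx => by
        have := congrArg φ hcx
        simpa [LinearMap.mem_ker.1 hx, hy] using this)
      (fun z => ⟨-(φ z / φ y), by simp [hy]⟩)
    have hb' : (b' : Fin (n + 1) → V) = Fin.cons y (Subtype.val ∘ b) :=
      Module.Basis.coe_mkFinCons ..
    refine ⟨b', fun j => ?_⟩
    induction j using Fin.cases with
    | zero =>
      have : Ici (0 : Fin (n + 1)) = univ := by ext; simp
      rw [this, image_univ, b'.span_eq]
      trivial
    | succ j =>
      have h1 := Submodule.mem_map_of_mem (f := (LinearMap.ker φ).subtype) (hb j)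
      rw [Submodule.map_span, ← image_comp] at h1
      have h2 : b' j.succ = b j := by rw [hb']; rfl
      rw [h2]
      refine Submodule.span_mono ?_ h1
      rintro _ ⟨i, hi, rfl⟩
      exact ⟨i.succ, by simpa using hi, by rw [hb']; rfl⟩

end LinearAlgebra

section ConjugateProducts

variable {G : Type*} [Group G]

/-- The products of a conjugate of `g` and a conjugate of `g⁻¹`. -/
def conjMulConjInv (g : G) : Set G := {x | ∃ a b, x = a * g * a⁻¹ * (b * g⁻¹ * b⁻¹)}

theorem conj_mem_conjMulConjInv_pow {g x : G} {N : ℕ} (hx : x ∈ conjMulConjInv g ^ N) (c : G) :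
    c * x * c⁻¹ ∈ conjMulConjInv g ^ N := by
  induction N generalizing x with
  | zero => simp_all
  | succ N ih =>
    rw [pow_succ] at hx ⊢
    obtain ⟨y, hy, z, ⟨a, b, rfl⟩, rfl⟩ := hx
    exact ⟨c * y * c⁻¹, ih hy, _, ⟨c * a, c * b, rfl⟩, by dsimp only; group⟩

theorem IsConj.mem_conjMulConjInv_pow {g x y : G} {N : ℕ} (hxy : IsConj x y)
    (hx : x ∈ conjMulConjInv g ^ N) : y ∈ conjMulConjInv g ^ N := by
  obtain ⟨c, rfl⟩ := isConj_iff.1 hxy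
  exact conj_mem_conjMulConjInv_pow hx c

theorem IsConj.conjMulConjInv_subset {g h : G} (hgh : IsConj g h) :
    conjMulConjInv h ⊆ conjMulConjInv g := by
  obtain ⟨c, rfl⟩ := isConj_iff.1 hgh
  rintro _ ⟨a, b, rfl⟩
  exact ⟨a * c, b * c, by group⟩

theorem commutator_mem_conjMulConjInv_sq {h u t y : G} (ht : h * u = t * h) (huy : u * y = y * u) :
    t * y * t⁻¹ * y⁻¹ ∈ conjMulConjInv h ^ 2 := by
  obtain rfl : t = h * u * h⁻¹ := by rw [ht]; group
  rw [pow_two]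
  refine ⟨h * (u * h⁻¹ * u⁻¹), ⟨1, u, by group⟩, y * u * h * u⁻¹ * y⁻¹ * (y * h⁻¹ * y⁻¹),
    ⟨y * u, y, by group⟩, ?_⟩
  have : u⁻¹ * y * u = y := by rw [mul_assoc, ← huy]; group
  calc _ = h * u * h⁻¹ * (u⁻¹ * y * u) * (h * u⁻¹ * h⁻¹) * y⁻¹ := by group
    _ = _ := by rw [this]; group

theorem conjMulConjInv_pow_subset_CN (g : G) (N : ℕ) : conjMulConjInv g ^ N ⊆ CN (2 * N) g := by
  have h : conjMulConjInv g ⊆ ({x | IsConj g x} ∪ {x | IsConj g⁻¹ x}) ^ 2 := by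
    rintro _ ⟨a, b, rfl⟩
    rw [pow_two]
    exact mul_mem_mul (.inl (isConj_iff.2 ⟨a, rfl⟩)) (.inr (isConj_iff.2 ⟨b, rfl⟩))
  intro x hx
  rw [CN, mem_iUnion₂]
  exact ⟨2 * N, le_rfl, by rw [pow_mul]; exact pow_subset_pow_left h hx⟩

end ConjugateProducts

section SpecialLinear

open Matrix

variable {n : Type*} [Fintype n] [DecidableEq n]

theorem Matrix.SpecialLinearGroup.eq_of_coe_eq {R : Type*} [CommRing R]
    {g h : SpecialLinearGroup n R} (hgh : (g : Matrix n n R) = h) : g = h := Subtype.ext hgh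

theorem Matrix.SpecialLinearGroup.exists_coe_eq {R : Type*} [CommRing R]
    {M : Matrix n n R} (hM : M.det = 1) : ∃ g : SpecialLinearGroup n R, (g : Matrix n n R) = M :=
  ⟨⟨M, hM⟩, rfl⟩

theorem Matrix.SpecialLinearGroup.isConj_of_mul_eq_mul {K : Type*} [Field K] [IsAlgClosed K]
    {g h : SpecialLinearGroup n K} {P : Matrix n n K} (hP : P.det ≠ 0)
    (hgh : (g : Matrix n n K) * P = P * h) : IsConj g h := by
  cases isEmpty_or_nonempty n
  · rw [Subsingleton.elim g h]
  obtain ⟨c, hc⟩ := IsAlgClosed.exists_pow_nat_eq P.det⁻¹ (Fintype.card_pos (α := n))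
  obtain ⟨p, hp⟩ := Matrix.SpecialLinearGroup.exists_coe_eq (M := c • P)
    (by rw [det_smul, hc, inv_mul_cancel₀ hP])
  refine isConj_iff.2 ⟨p⁻¹, ?_⟩
  rw [inv_inv, mul_assoc, inv_mul_eq_iff_eq_mul]
  apply Matrix.SpecialLinearGroup.eq_of_coe_eq
  rw [Matrix.SpecialLinearGroup.coe_mul, Matrix.SpecialLinearGroup.coe_mul, hp, mul_smul_comm, hgh,
    smul_mul_assoc]

theorem Matrix.det_one_add_of_sq_eq_zero {N : Matrix n n ℂ}
    (hN : N * N = 0) : (1 + N).det = 1 := by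
  have h1 := (Matrix.isNilpotent_charpoly_sub_pow_of_isNilpotent
    (⟨2, by rw [pow_two, hN]⟩ : IsNilpotent N)).eq_zero
  have h2 := congrArg (Polynomial.eval (-1)) (sub_eq_zero.1 h1)
  rw [Matrix.eval_charpoly] at h2
  have h3 : scalar n (-1 : ℂ) - N = -(1 + N) := by
    rw [map_neg, map_one]; abel
  rw [h3, det_neg, Polynomial.eval_pow, Polynomial.eval_X] at h2
  exact mul_left_cancel₀ (pow_ne_zero _ (neg_ne_zero.2 one_ne_zero)) (h2.trans (mul_one _).symm)

/-- The unipotent element `1 + N` for `N² = 0`. -/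
def unipotentOfSq (N : Matrix n n ℂ) (hN : N * N = 0) :
    SpecialLinearGroup n ℂ := ⟨1 + N, det_one_add_of_sq_eq_zero hN⟩

theorem coe_unipotentOfSq (N : Matrix n n ℂ) (hN : N * N = 0) :
    (unipotentOfSq N hN : Matrix n n ℂ) = 1 + N := rfl

theorem coe_unipotentOfSq_inv (N : Matrix n n ℂ) (hN : N * N = 0) :
    ((unipotentOfSq N hN)⁻¹ : SpecialLinearGroup n ℂ) = 1 - N := by
  have : unipotentOfSq N hN * unipotentOfSq (-N) (by simpa using hN) = 1 := by
    apply Matrix.SpecialLinearGroup.eq_of_coe_eq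
    simp [coe_unipotentOfSq, mul_add, add_mul, hN]
  rw [inv_eq_of_mul_eq_one_right this]
  rw [coe_unipotentOfSq, sub_eq_add_neg]

/-- The weighted permutation matrix with entries `c i` at the positions `(i, σ i)`. -/
def weightedPerm {K : Type*} [Zero K] (σ : Equiv.Perm n) (c : n → K) : Matrix n n K :=
  of fun i j => if j = σ i then c i else 0

theorem weightedPerm_mulVec {K : Type*} [NonAssocSemiring K] (σ : Equiv.Perm n) (c f : n → K)
    (i : n) : (weightedPerm σ c *ᵥ f) i = c i * f (σ i) := by
  simp [weightedPerm, mulVec, dotProduct]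

/-- If `h` maps `e_i` to `e_{σ i}` for `i ∈ I`, with `I` and `σ I` disjoint, then every diagonal
matrix with entries `ν_i², ν_i⁻²` at `i, σ i` is obtained from two commutators of `h`. -/
theorem exists_diagonal_mem_of_col (h : SpecialLinearGroup n ℂ) (σ : Equiv.Perm n) (I : Finset n)
    (hσ : ∀ i ∈ I, σ i ∉ I) (hcol : ∀ i ∈ I, ∀ j, h j i = if j = σ i then 1 else 0)
    (ν : n → ℂ) (hν : ∀ i, ν i ≠ 0) (hν' : ∀ i, ν i ^ 2 ≠ -1) :
    ∃ D : SpecialLinearGroup n ℂ, D ∈ conjMulConjInv h ^ 2 ∧ (D : Matrix n n ℂ) =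
      diagonal fun j => (if j ∈ I then ν j ^ 2 else 1) *
        (if σ.symm j ∈ I then (ν (σ.symm j) ^ 2)⁻¹ else 1) := by
  set E : Matrix n n ℂ := diagonal fun i => if i ∈ I then 1 else 0 with hE
  set M : Matrix n n ℂ := weightedPerm σ.symm fun j => if σ.symm j ∈ I then 1 else 0 with hM
  set Y : Matrix n n ℂ := weightedPerm σ fun i => if i ∈ I then ν i - (ν i)⁻¹ else 0 with hY
  set Z : Matrix n n ℂ := diagonal fun j => if σ.symm j ∈ I then
    ν (σ.symm j) - (ν (σ.symm j))⁻¹ else 0 with hZ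
  have hσ' : ∀ j ∈ I, σ.symm j ∉ I := fun j hj h => hσ _ h (by simpa using hj)
  have hhE : (h : Matrix n n ℂ) * E = M := by
    ext i j
    rw [hE, mul_diagonal, hM, weightedPerm, of_apply]
    by_cases hj : j ∈ I
    · rw [hcol j hj]
      by_cases hij : i = σ j
      · subst hij; simp [hj]
      · have : j ≠ σ.symm i := fun h => hij (by simp [h])
        simp [hij, this]
    · by_cases hij : j = σ.symm i
      · subst hij; simp [hj]
      · simp [hj, hij]
  have hhY : (h : Matrix n n ℂ) * Y = Z := by
    ext i j
    obtain ⟨k, rfl⟩ := σ.surjective j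
    rw [hZ, hY, mul_apply, diagonal_apply, Finset.sum_eq_single k]
    · by_cases hk : k ∈ I
      · rw [hcol k hk]; simp only [weightedPerm, of_apply, if_true, hk]
        by_cases hik : i = σ k
        · subst hik; simp [hk]
        · simp [hik]
      · by_cases hik : i = σ k
        · subst hik; simp [weightedPerm, hk]
        · simp [weightedPerm, hk, hik]
    · intro l _ hl
      simp [weightedPerm, hl.symm]
    · simp
  have hEM : E * M = 0 := by
    refine ext_of_mulVec_single fun k => funext fun j => ?_
    rw [← mulVec_mulVec, hE, mulVec_diagonal, hM, weightedPerm_mulVec]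
    by_cases hj : j ∈ I <;> simp [hj, hσ']
  have hYE : Y * E = 0 := by
    refine ext_of_mulVec_single fun k => funext fun j => ?_
    rw [← mulVec_mulVec, hY, weightedPerm_mulVec, hE, mulVec_diagonal]
    by_cases hj : j ∈ I <;> simp [hj, hσ]
  have hEZ : E * Z = 0 := by
    rw [hE, hZ, diagonal_mul_diagonal, ← diagonal_zero]
    congr 1; funext j
    by_cases hj : j ∈ I <;> simp [hj, hσ']
  have hMM : M * M = 0 := by
    conv_lhs => rw [← hhE, mul_assoc, hhE, hEM, mul_zero]
  have hYY : Y * Y = 0 := by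
    refine ext_of_mulVec_single fun k => funext fun j => ?_
    rw [← mulVec_mulVec, hY, weightedPerm_mulVec, weightedPerm_mulVec]
    by_cases hj : j ∈ I <;> simp [hj, hσ]
  have hNN : E * h * (E * h) = 0 := by
    rw [mul_assoc, ← mul_assoc (h : Matrix n n ℂ), hhE, ← mul_assoc, hEM, zero_mul]
  set C := unipotentOfSq M hMM * unipotentOfSq Y hYY * (unipotentOfSq M hMM)⁻¹ *
    (unipotentOfSq Y hYY)⁻¹ with hC
  have hCmem : C ∈ conjMulConjInv h ^ 2 := by
    refine commutator_mem_conjMulConjInv_sq (u := unipotentOfSq _ hNN) ?_ ?_ <;>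
      apply Matrix.SpecialLinearGroup.eq_of_coe_eq <;>
      simp only [coe_unipotentOfSq, Matrix.SpecialLinearGroup.coe_mul]
    · rw [← hhE, mul_add, add_mul, mul_one, one_mul, mul_assoc]
    · simp only [mul_add, add_mul, mul_assoc, hhY, hEZ, mul_one, one_mul]
      rw [← mul_assoc Y E, hYE, zero_mul]
      abel
  have hCcoe : (C : Matrix n n ℂ) = (1 + M) * (1 + Y) * (1 - M) * (1 - Y) := by
    rw [hC]
    simp only [Matrix.SpecialLinearGroup.coe_mul, coe_unipotentOfSq_inv, coe_unipotentOfSq]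
  set δ : n → ℂ := fun j => (if j ∈ I then ν j ^ 2 else 1) *
        (if σ.symm j ∈ I then (ν (σ.symm j) ^ 2)⁻¹ else 1) with hδ
  set P : Matrix n n ℂ := diagonal (fun i => if i ∈ I then 1 - (ν i)⁻¹ else 1) +
    weightedPerm σ (fun i => if i ∈ I then ν i + 1 else 0) + M with hP
  have hPdet : P.det ≠ 0 := by
    rw [Ne, ← exists_mulVec_eq_zero_iff]
    rintro ⟨f, hf0, hf⟩
    have hf' : ∀ j, (if j ∈ I then 1 - (ν j)⁻¹ else 1) * f j +
        (if j ∈ I then ν j + 1 else 0) * f (σ j) +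
        (if σ.symm j ∈ I then 1 else 0) * f (σ.symm j) = 0 := fun j => by
      have := congrFun hf j
      simpa only [hP, hM, add_mulVec, Pi.add_apply, mulVec_diagonal, weightedPerm_mulVec,
        Pi.zero_apply] using this
    have hI : ∀ i ∈ I, f i = 0 ∧ f (σ i) = 0 := fun i hi => by
      have h1 := hf' i
      have h2 := hf' (σ i)
      simp only [hi, hσ i hi, hσ' i hi, if_true, if_false, Equiv.symm_apply_apply] at h1 h2
      have h3 : f i * (ν i ^ 2 + 1) = 0 := by
        have := hν i
        field_simp at h1
        linear_combination (-1 : ℂ) * h1 + (ν i ^ 2 + ν i) * h2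
      have h4 : f i = 0 :=
        (mul_eq_zero.1 h3).resolve_right fun h => hν' i (eq_neg_of_add_eq_zero_left h)
      exact ⟨h4, by linear_combination h2 - h4⟩
    refine hf0 (funext fun j => ?_)
    by_cases hj : j ∈ I
    · exact (hI j hj).1
    by_cases hj' : σ.symm j ∈ I
    · simpa using (hI _ hj').2
    · simpa [hj, hj'] using hf' j
  have hCP : (C : Matrix n n ℂ) * P = P * diagonal δ := by
    rw [hCcoe]
    refine ext_of_mulVec_single fun k => funext fun j => ?_
    generalize (Pi.single k (1 : ℂ) : n → ℂ) = f
    simp only [← mulVec_mulVec, hP, hM, hY, add_mulVec, sub_mulVec, one_mulVec, Pi.add_apply,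
      Pi.sub_apply, mulVec_diagonal, weightedPerm_mulVec, hδ]
    by_cases hj : j ∈ I
    · have := hν j
      simp only [hj, hσ j hj, hσ' j hj, if_true, if_false, Equiv.symm_apply_apply]
      field_simp
      ring
    obtain ⟨i, rfl⟩ := σ.surjective j
    by_cases hi : i ∈ I
    · have := hν i
      simp only [hi, hσ i hi, hσ' i hi, if_true, if_false, Equiv.symm_apply_apply]
      field_simp
      ring
    · simp only [hi, hj, if_false, Equiv.symm_apply_apply]
      ring
  have hdet : (diagonal δ).det = 1 := by
    have := congrArg det hCP
    rw [det_mul, det_mul, C.det_coe, one_mul] at this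
    exact (mul_left_cancel₀ hPdet ((mul_one _).trans this)).symm
  obtain ⟨D, hD⟩ := Matrix.SpecialLinearGroup.exists_coe_eq hdet
  exact ⟨D, (SpecialLinearGroup.isConj_of_mul_eq_mul hPdet (hD ▸ hCP)
    ).mem_conjMulConjInv_pow hCmem, hD⟩

theorem exists_diagonal_mem (g : SpecialLinearGroup n ℂ) (σ : Equiv.Perm n) (I : Finset n)
    (hσ : ∀ i ∈ I, σ i ∉ I)
    (hrank : ∀ a : ℂ, 4 * I.card < ((g : Matrix n n ℂ) - a • (1 : Matrix n n ℂ)).rank + 4)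
    (ν : n → ℂ) (hν : ∀ i, ν i ≠ 0) (hν' : ∀ i, ν i ^ 2 ≠ -1) :
    ∃ D : SpecialLinearGroup n ℂ, D ∈ conjMulConjInv g ^ 2 ∧ (D : Matrix n n ℂ) =
      diagonal fun j => (if j ∈ I then ν j ^ 2 else 1) *
        (if σ.symm j ∈ I then (ν (σ.symm j) ^ 2)⁻¹ else 1) := by
  obtain ⟨w₀, hw₀, hw₀g⟩ := exists_linearIndepOn_map_eq (toLin' (g : Matrix n n ℂ)) σ I
    (by
      rw [Finset.disjoint_right]
      intro j hj
      obtain ⟨i, hi, rfl⟩ := Finset.mem_image.1 hj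
      exact hσ i hi)
    (fun a => by
      have := hrank a
      rwa [rank, ← toLin'_apply', map_sub, map_smul, toLin'_one] at this)
  obtain ⟨w, hw, hww₀⟩ := hw₀.exists_extend_finset (by simp)
  set P : Matrix n n ℂ := (of w)ᵀ with hP
  have hPdet : IsUnit P.det := by
    rw [← isUnit_iff_isUnit_det, ← linearIndependent_cols_iff_isUnit]
    exact hw
  have hwg : ∀ i ∈ I, (g : Matrix n n ℂ) *ᵥ w i = w (σ i) := fun i hi => by
    rw [hww₀ i (by simp [hi]), hww₀ (σ i) (by simp [hi]), hw₀g i hi, toLin'_apply]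
  have hPw : ∀ i, P *ᵥ (Pi.single i 1 : n → ℂ) = w i := fun i => by
    ext j; simp [hP]
  obtain ⟨h, hh⟩ := Matrix.SpecialLinearGroup.exists_coe_eq (M := P⁻¹ * (g : Matrix n n ℂ) * P) (by
    rw [det_mul, det_mul, g.det_coe, mul_one, ← det_mul, nonsing_inv_mul _ hPdet, det_one])
  have hgh : IsConj g h := SpecialLinearGroup.isConj_of_mul_eq_mul hPdet.ne_zero (by
    rw [hh, ← mul_assoc, ← mul_assoc, mul_nonsing_inv _ hPdet, one_mul])
  have hcol : ∀ i ∈ I, ∀ j, h j i = if j = σ i then 1 else 0 := fun i hi j => by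
    have : (h : Matrix n n ℂ) *ᵥ (Pi.single i 1 : n → ℂ) = Pi.single (σ i) 1 := by
      rw [hh, ← mulVec_mulVec, hPw, ← mulVec_mulVec, hwg i hi, ← hPw, mulVec_mulVec,
        nonsing_inv_mul _ hPdet, one_mulVec]
    have := congrFun this j
    rwa [mulVec_single_one, Pi.single_apply] at this
  obtain ⟨D, hD, hDcoe⟩ := exists_diagonal_mem_of_col h σ I hσ hcol ν hν hν'
  exact ⟨D, pow_subset_pow_left hgh.conjMulConjInv_subset hD, hDcoe⟩

end SpecialLinear

section DiagonalElements

open Matrix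

theorem Complex.exists_pow_four_eq (z : ℂ) : ∃ w : ℂ, w ^ 4 = z ∧ w ^ 2 ≠ -1 := by
  obtain ⟨w, hw⟩ := IsAlgClosed.exists_pow_nat_eq z (n := 4) (by norm_num)
  by_cases h : w ^ 2 = -1
  · refine ⟨1, ?_, by norm_num⟩
    rw [← hw, show w ^ 4 = (w ^ 2) ^ 2 by ring, h]
    norm_num
  · exact ⟨w, hw, h⟩

theorem card_filter_mod_eq_le (k q c : ℕ) :
    (Finset.univ.filter fun j : Fin (k + 1) => (j : ℕ) % q = c ∧ (j : ℕ) < k).card ≤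
      (k - 1) / q + 1 := by
  rw [← Finset.card_range ((k - 1) / q + 1)]
  refine Finset.card_le_card_of_injOn (fun j => (j : ℕ) / q) (fun j hj => ?_) fun i hi j hj h => ?_
  · simp only [Finset.coe_filter, Finset.mem_univ, true_and, mem_ofPred_eq] at hj
    simpa [Nat.lt_succ_iff] using Nat.div_le_div_right (c := q) (Nat.le_sub_one_of_lt hj.2)
  · simp only [Finset.coe_filter, Finset.mem_univ, true_and, mem_ofPred_eq] at hi hj
    ext
    rw [← Nat.div_add_mod (i : ℕ) q, ← Nat.div_add_mod (j : ℕ) q, hi.1, hj.1]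
    exact congrArg (q * · + c) h

theorem diagonal_mem_conjMulConjInv_pow {k q : ℕ} (hq : 2 ≤ q)
    (g : SpecialLinearGroup (Fin (k + 1)) ℂ)
    (hg : ∀ a : ℂ, 4 * (k + 1) ≤ q * ((g : Matrix (Fin (k + 1)) (Fin (k + 1)) ℂ) - a • (1 : Matrix (Fin (k + 1)) (Fin (k + 1)) ℂ)).rank)
    {D : SpecialLinearGroup (Fin (k + 1)) ℂ} {d : Fin (k + 1) → ℂ}
    (hD : (D : Matrix (Fin (k + 1)) (Fin (k + 1)) ℂ) = diagonal d) : D ∈ conjMulConjInv g ^ (4 * q) := by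
  have hdet : ∏ i, d i = 1 := by rw [← det_diagonal, ← hD, D.det_coe]
  have hd : ∀ i, d i ≠ 0 := fun i h => by
    rw [Finset.prod_eq_zero (Finset.mem_univ i) h] at hdet
    exact zero_ne_one hdet
  set d' : ℕ → ℂ := fun i => if h : i < k + 1 then d ⟨i, h⟩ else 1 with hd'
  have hdd' : ∀ i : Fin (k + 1), d i = d' i := fun i => by
    simp only [hd', dif_pos i.2]
  set μ : ℕ → ℂ := fun j => ∏ i ∈ Finset.range (j + 1), d' i with hμ
  have hμk : μ k = 1 := by
    rw [← hdet]
    refine (Finset.prod_range _).trans ?_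
    exact Finset.prod_congr rfl fun i _ => (hdd' i).symm
  have hμ0 : ∀ j, μ j ≠ 0 := fun j => Finset.prod_ne_zero_iff.2 fun i _ => by
    simp only [hd']
    split_ifs
    exacts [hd _, one_ne_zero]
  choose ρ hρ hρ' using fun j => Complex.exists_pow_four_eq (μ j)
  have hρ0 : ∀ j, ρ j ≠ 0 := fun j h => hμ0 j (by rw [← hρ, h]; norm_num)
  let I : ℕ → Finset (Fin (k + 1)) := fun c =>
    Finset.univ.filter fun j => (j : ℕ) % q = c ∧ (j : ℕ) < k
  have hI : ∀ c (j : Fin (k + 1)), j ∈ I c ↔ (j : ℕ) % q = c ∧ (j : ℕ) < k := by simp [I]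
  have hσ : ∀ c, ∀ i ∈ I c, finRotate (k + 1) i ∉ I c := fun c i hi h => by
    rw [hI] at hi h
    rw [coe_finRotate_of_ne_last (by rintro rfl; simp at hi)] at h
    have h1 : (i : ℕ) ≡ i + 1 [MOD q] := hi.1.trans h.1.symm
    have h2 := (Nat.modEq_iff_dvd' (Nat.le_add_right _ 1)).1 h1
    rw [Nat.add_sub_cancel_left, Nat.dvd_one] at h2
    omega
  have hrank : ∀ c (a : ℂ),
      4 * (I c).card < ((g : Matrix (Fin (k + 1)) (Fin (k + 1)) ℂ) - a • (1 : Matrix (Fin (k + 1)) (Fin (k + 1)) ℂ)).rank + 4 := fun c a => by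
    have h1 := card_filter_mod_eq_le k q c
    have h2 := hg a
    have h3 := Nat.mul_div_le (k - 1) q
    have h4 : q * (4 * ((k - 1) / q)) <
        q * ((g : Matrix (Fin (k + 1)) (Fin (k + 1)) ℂ) - a • (1 : Matrix (Fin (k + 1)) (Fin (k + 1)) ℂ)).rank := by
      refine lt_of_lt_of_le ?_ h2
      rw [mul_left_comm]
      omega
    have h5 := lt_of_mul_lt_mul_left' h4
    change 4 * (I c).card < _
    have h6 : (I c).card ≤ (k - 1) / q + 1 := h1
    omega
  choose E hE hEcoe using fun c => exists_diagonal_mem g (finRotate (k + 1)) (I c) (hσ c) (hrank c)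
    (fun j => ρ j) (fun j => hρ0 j) (fun j => hρ' j)
  have hprod : ∀ s, ∃ F : SpecialLinearGroup (Fin (k + 1)) ℂ, F ∈ conjMulConjInv g ^ (4 * s) ∧
      (F : Matrix (Fin (k + 1)) (Fin (k + 1)) ℂ) = diagonal fun j => ∏ c ∈ Finset.range s,
        ((if j ∈ I c then μ j else 1) * (if (finRotate (k + 1)).symm j ∈ I c then
          (μ ((finRotate (k + 1)).symm j))⁻¹ else 1)) := fun s => by
    induction s with
    | zero => exact ⟨1, by simp, by simp⟩
    | succ s ih =>
      obtain ⟨F, hF, hFcoe⟩ := ih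
      refine ⟨F * (E s * E s), ?_, ?_⟩
      · rw [mul_add, pow_add, show 4 * 1 = 2 + 2 from rfl, pow_add _ 2]
        exact mul_mem_mul hF (mul_mem_mul (hE s) (hE s))
      · rw [Matrix.SpecialLinearGroup.coe_mul, Matrix.SpecialLinearGroup.coe_mul, hFcoe, hEcoe,
          diagonal_mul_diagonal, diagonal_mul_diagonal]
        congr 1
        funext j
        rw [Finset.prod_range_succ, ← hρ, ← hρ]
        congr 1
        split_ifs <;> ring
  obtain ⟨F, hF, hFcoe⟩ := hprod q
  have hq0 : 0 < q := by omega
  have hite : ∀ (j : Fin (k + 1)) (x : ℂ), ((j : ℕ) = k → x = 1) →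
      ∏ c ∈ Finset.range q, (if j ∈ I c then x else 1) = x := fun j x hx => by
    simp only [hI]
    by_cases hj : (j : ℕ) < k
    · simp [hj, Nat.mod_lt _ hq0]
    · rw [hx (by omega)]
      simp
  suffices D = F by rwa [this]
  apply Matrix.SpecialLinearGroup.eq_of_coe_eq
  rw [hD, hFcoe]
  congr 1
  funext j
  rw [Finset.prod_mul_distrib, hite _ _ (fun h => by rw [h, hμk]),
    hite _ _ (fun h => by rw [h, hμk, inv_one])]
  refine Fin.cases ?_ (fun i => ?_) j
  · rw [show (finRotate (k + 1)).symm 0 = Fin.last k by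
      rw [Equiv.symm_apply_eq, finRotate_last], Fin.val_last, hμk, hdd']
    simp [hμ]
  · rw [show (finRotate (k + 1)).symm i.succ = i.castSucc by
      rw [Equiv.symm_apply_eq, finRotate_apply, Fin.coeSucc_eq_succ], hdd', Fin.val_succ,
      Fin.val_castSucc, eq_mul_inv_iff_mul_eq₀ (hμ0 _)]
    simp only [hμ]
    rw [Finset.prod_range_succ _ (i + 1 : ℕ), mul_comm]

end DiagonalElements

section Generation

open Matrix

theorem Matrix.SpecialLinearGroup.exists_isConj_forall_lt_eq_zero {K : Type*} [Field K]
    [IsAlgClosed K] {m : ℕ} (x : SpecialLinearGroup (Fin m) K) :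
    ∃ t : SpecialLinearGroup (Fin m) K, IsConj x t ∧ ∀ i j, i < j → t i j = 0 := by
  obtain ⟨b, hb⟩ := exists_basis_forall_repr_eq_zero m (by simp)
    (Matrix.toLin' (x : Matrix (Fin m) (Fin m) K))
  set e := Pi.basisFun K (Fin m)
  set f := Matrix.toLin' (x : Matrix (Fin m) (Fin m) K) with hf
  have hP : (e.toMatrix b).det ≠ 0 := by
    have := e.invertibleToMatrix b
    exact (Matrix.isUnit_det_of_invertible _).ne_zero
  have hxP : (x : Matrix (Fin m) (Fin m) K) * e.toMatrix b =
      e.toMatrix b * LinearMap.toMatrix b b f := by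
    rw [basis_toMatrix_mul_linearMap_toMatrix, ← linearMap_toMatrix_mul_basis_toMatrix (b' := e),
      hf, LinearMap.toMatrix_eq_toMatrix', LinearMap.toMatrix'_toLin']
  obtain ⟨t, ht⟩ := Matrix.SpecialLinearGroup.exists_coe_eq (M := LinearMap.toMatrix b b f) (by
    have := congrArg det hxP
    rw [det_mul, det_mul, x.det_coe, one_mul] at this
    exact (mul_left_cancel₀ hP ((mul_one _).trans this)).symm)
  refine ⟨t, SpecialLinearGroup.isConj_of_mul_eq_mul hP (ht ▸ hxP), fun i j hij => ?_⟩
  rw [ht, LinearMap.toMatrix_apply]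
  exact hb i j hij

theorem Matrix.SpecialLinearGroup.isConj_diagonal {K : Type*} [Field K] [IsAlgClosed K] {m : ℕ}
    {t D : SpecialLinearGroup (Fin m) K} {z : Fin m → K} (hz : Function.Injective z)
    (hD : (D : Matrix (Fin m) (Fin m) K) = diagonal z) (ht : ∀ i j, i < j → t i j = 0)
    (htz : ∀ i, t i i = z i) : IsConj t D := by
  have hv : ∀ i, ∃ v : Fin m → K, v ≠ 0 ∧ (t : Matrix (Fin m) (Fin m) K) *ᵥ v = z i • v := by
    intro i
    have hdet : ((t : Matrix (Fin m) (Fin m) K) - z i • (1 : Matrix (Fin m) (Fin m) K)).det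
        = 0 := by
      rw [det_of_isLowerTriangular _ fun a b hab => ?_]
      · exact Finset.prod_eq_zero (Finset.mem_univ i) (by simp [htz])
      · have hab' : a < b := hab
        simp [ht a b hab', hab'.ne]
    obtain ⟨v, hv0, hv⟩ := exists_mulVec_eq_zero_iff.2 hdet
    refine ⟨v, hv0, ?_⟩
    rwa [sub_mulVec, smul_mulVec, one_mulVec, sub_eq_zero] at hv
  choose v hv0 hv using hv
  have hli : LinearIndependent K v := Module.End.eigenvectors_linearIndependent'
    (Matrix.toLin' (t : Matrix (Fin m) (Fin m) K)) z hz v fun i =>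
      ⟨Module.End.mem_eigenspace_iff.2 (by rw [Matrix.toLin'_apply, hv]), hv0 i⟩
  have hP : IsUnit ((of v)ᵀ).det := by
    rw [← isUnit_iff_isUnit_det, ← linearIndependent_cols_iff_isUnit]
    exact hli
  refine SpecialLinearGroup.isConj_of_mul_eq_mul hP.ne_zero ?_
  rw [hD]
  ext i j
  rw [mul_diagonal]
  have := congrFun (hv j) i
  simpa [mulVec, dotProduct, mul_apply, mul_comm] using this

theorem Matrix.SpecialLinearGroup.exists_injective_diagonal {m : ℕ} (hm : m ≠ 0) :
    ∃ (D : SpecialLinearGroup (Fin m) ℂ) (z : Fin m → ℂ), Function.Injective z ∧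
      (D : Matrix (Fin m) (Fin m) ℂ) = diagonal z := by
  have hp : ∏ i : Fin m, ((i : ℂ) + 1) ≠ 0 :=
    Finset.prod_ne_zero_iff.2 fun i _ => Nat.cast_add_one_ne_zero _
  obtain ⟨c, hc⟩ := IsAlgClosed.exists_pow_nat_eq (∏ i : Fin m, ((i : ℂ) + 1))⁻¹
    (Nat.pos_of_ne_zero hm)
  have hc0 : c ≠ 0 := fun h => by
    rw [h, zero_pow hm] at hc
    exact inv_ne_zero hp hc.symm
  obtain ⟨D, hD⟩ := Matrix.SpecialLinearGroup.exists_coe_eq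
    (M := diagonal fun i : Fin m => c * ((i : ℂ) + 1)) (by
      rw [det_diagonal, Finset.prod_mul_distrib, Finset.prod_const, Finset.card_univ,
        Fintype.card_fin, hc, inv_mul_cancel₀ hp])
  refine ⟨D, _, fun i j hij => ?_, hD⟩
  simpa [hc0, Fin.ext_iff] using hij

theorem mem_conjMulConjInv_pow_of_rank {m q : ℕ} (hm : m ≠ 0) (hq : 2 ≤ q)
    (g : SpecialLinearGroup (Fin m) ℂ)
    (hg : ∀ a : ℂ, 4 * m ≤
      q * ((g : Matrix (Fin m) (Fin m) ℂ) - a • (1 : Matrix (Fin m) (Fin m) ℂ)).rank)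
    (x : SpecialLinearGroup (Fin m) ℂ) : x ∈ conjMulConjInv g ^ (8 * q) := by
  obtain ⟨D, z, hz, hD⟩ := Matrix.SpecialLinearGroup.exists_injective_diagonal hm
  obtain ⟨t, hxt, ht⟩ := x.exists_isConj_forall_lt_eq_zero
  obtain ⟨k, rfl⟩ := Nat.exists_eq_succ_of_ne_zero hm
  have hdiag {E : SpecialLinearGroup (Fin (k + 1)) ℂ} {d : Fin (k + 1) → ℂ} :
      (E : Matrix (Fin (k + 1)) (Fin (k + 1)) ℂ) = diagonal d → E ∈ conjMulConjInv g ^ (4 * q) :=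
    diagonal_mem_conjMulConjInv_pow hq g hg
  have hzprod : ∏ i, z i = 1 := by rw [← det_diagonal, ← hD, D.det_coe]
  have htprod : ∏ i, t i i = 1 := by
    rw [← det_of_isLowerTriangular _ fun a b hab => ht a b hab, t.det_coe]
  have hz0 : ∀ i, z i ≠ 0 := fun i => Finset.prod_ne_zero_iff.1 (by simp [hzprod]) i
    (Finset.mem_univ i)
  have ht0 : ∀ i, t i i ≠ 0 := fun i => Finset.prod_ne_zero_iff.1
    (htprod.trans_ne one_ne_zero) i (Finset.mem_univ i)
  obtain ⟨E, hE⟩ := Matrix.SpecialLinearGroup.exists_coe_eq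
    (M := diagonal fun i => z i * (t i i)⁻¹)
    (by rw [det_diagonal, Finset.prod_mul_distrib, Finset.prod_inv_distrib, hzprod, htprod,
      inv_one, one_mul])
  obtain ⟨F, hF⟩ := Matrix.SpecialLinearGroup.exists_coe_eq
    (M := diagonal fun i => t i i * (z i)⁻¹)
    (by rw [det_diagonal, Finset.prod_mul_distrib, Finset.prod_inv_distrib, hzprod, htprod,
      inv_one, one_mul])
  have hFE : F * E = 1 := by
    apply Matrix.SpecialLinearGroup.eq_of_coe_eq
    rw [Matrix.SpecialLinearGroup.coe_mul, hE, hF, diagonal_mul_diagonal,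
      Matrix.SpecialLinearGroup.coe_one, ← diagonal_one]
    congr 1
    funext i
    have h1 := hz0 i
    have h2 := ht0 i
    field_simp
  have hconj : IsConj (E * t) D := by
    have hmul : ∀ i j, (E * t) i j = z i * (t i i)⁻¹ * t i j := fun i j => by
      rw [Matrix.SpecialLinearGroup.coe_mul, hE, diagonal_mul]
    refine Matrix.SpecialLinearGroup.isConj_diagonal hz hD (fun i j hij => ?_) fun i => ?_
    · rw [hmul, ht i j hij, mul_zero]
    · rw [hmul, inv_mul_cancel_right₀ (ht0 i)]
  refine hxt.symm.mem_conjMulConjInv_pow ?_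
  rw [show t = F * (E * t) by rw [← mul_assoc, hFE, one_mul], show 8 * q = 4 * q + 4 * q by ring,
    pow_add]
  exact mul_mem_mul (hdiag hF) (hconj.symm.mem_conjMulConjInv_pow (hdiag hD))

end Generation

section JordanLength

open Matrix

theorem mul_le_rank_of_le_jlen {m q : ℕ} (hm : m ≠ 0) {A : SpecialLinearGroup (Fin m) ℂ}
    {ρ : ℝ≥0∞} (hρ : 4 ≤ ρ * q) (hA : ρ ≤ jlen m (A : Matrix (Fin m) (Fin m) ℂ)) (a : ℂ) :
    4 * m ≤ q * ((A : Matrix (Fin m) (Fin m) ℂ) - a • (1 : Matrix (Fin m) (Fin m) ℂ)).rank := by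
  have hne : ∀ l : ℂ, l ≠ 0 → 4 * m ≤
      q * ((A : Matrix (Fin m) (Fin m) ℂ) - l • (1 : Matrix (Fin m) (Fin m) ℂ)).rank :=
      fun l hl => by
    have h1 : jlen m (A : Matrix (Fin m) (Fin m) ℂ) ≤
        ((A : Matrix (Fin m) (Fin m) ℂ) - l • (1 : Matrix (Fin m) (Fin m) ℂ)).rank / m := by
      refine ENNReal.div_le_div_right (Nat.cast_le.2 (Nat.sInf_le ?_)) _
      exact ⟨l, hl, rfl⟩
    rw [ENNReal.le_div_iff_mul_le (.inl (Nat.cast_ne_zero.2 hm))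
      (.inl (ENNReal.natCast_ne_top m))] at h1
    have h2 : (4 * m : ℝ≥0∞) ≤
        q * ((A : Matrix (Fin m) (Fin m) ℂ) - l • (1 : Matrix (Fin m) (Fin m) ℂ)).rank :=
      calc (4 * m : ℝ≥0∞) ≤ ρ * q * m := by gcongr
        _ ≤ jlen m (A : Matrix (Fin m) (Fin m) ℂ) * q * m := by gcongr
        _ = q * (jlen m (A : Matrix (Fin m) (Fin m) ℂ) * m) := by ring
        _ ≤ _ := by gcongr
    exact_mod_cast h2
  by_cases ha : a = 0
  · refine (hne 1 one_ne_zero).trans (Nat.mul_le_mul_left q ?_)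
    rw [ha, zero_smul, sub_zero, rank_of_isUnit (A : Matrix (Fin m) (Fin m) ℂ)
      ((isUnit_iff_isUnit_det _).2 (by rw [A.det_coe]; exact isUnit_one))]
    exact rank_le_card_width _
  · exact hne a ha

theorem half_le_jlen_diagonal {m : ℕ} (hm : 2 ≤ m) {z : Fin m → ℂ} (hz : Function.Injective z) :
    2⁻¹ ≤ jlen m (diagonal z) := by
  obtain ⟨l, -, hl⟩ := Nat.sInf_mem (s := {r : ℕ | ∃ l : ℂ, l ≠ 0 ∧
    r = (diagonal z - l • (1 : Matrix (Fin m) (Fin m) ℂ)).rank}) ⟨_, 1, one_ne_zero, rfl⟩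
  have hrank : m ≤ 2 * (diagonal z - l • (1 : Matrix (Fin m) (Fin m) ℂ)).rank := by
    rw [smul_one_eq_diagonal, diagonal_sub, rank_diagonal, Fintype.card_subtype_compl,
      Fintype.card_fin]
    have : Fintype.card {i // z i - l = 0} ≤ 1 := Fintype.card_le_one_iff.2 fun i j =>
      Subtype.ext (hz ((sub_eq_zero.1 i.2).trans (sub_eq_zero.1 j.2).symm))
    omega
  rw [jlen, hl, ENNReal.le_div_iff_mul_le (.inl (Nat.cast_ne_zero.2 (by omega)))
    (.inl (ENNReal.natCast_ne_top m)), ← ENNReal.div_eq_inv_mul,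
    ENNReal.div_le_iff (by norm_num) (by norm_num), mul_comm]
  exact_mod_cast hrank

end JordanLength

namespace PMFamily

variable (𝒢 : PMFamily) (U : Ultrafilter ℕ)

theorem mk_eq_mk_of_eventually_eq {g h : ∀ n, 𝒢.G n} (hgh : ∀ᶠ n in U, g n = h n) :
    (QuotientGroup.mk g : 𝒢.Q U) = QuotientGroup.mk h := by
  rw [QuotientGroup.eq, mem_E]
  intro ε hε
  filter_upwards [hgh] with n hn
  simpa [hn, 𝒢.norm_one] using hε

theorem mk_mem_conjMulConjInv_pow {N : ℕ} {g x : ∀ n, 𝒢.G n}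
    (hx : ∀ᶠ n in U, x n ∈ conjMulConjInv (g n) ^ N) :
    (QuotientGroup.mk x : 𝒢.Q U) ∈ conjMulConjInv (QuotientGroup.mk g : 𝒢.Q U) ^ N := by
  induction N generalizing x with
  | zero =>
    rw [pow_zero, Set.mem_one]
    exact 𝒢.mk_eq_mk_of_eventually_eq U (h := 1) (hx.mono fun n hn => by simpa using hn)
  | succ N ih =>
    have : ∀ n, ∃ y a b : 𝒢.G n, x n ∈ conjMulConjInv (g n) ^ (N + 1) →
        y ∈ conjMulConjInv (g n) ^ N ∧
          x n = y * (a * g n * a⁻¹ * (b * (g n)⁻¹ * b⁻¹)) := fun n => by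
      by_cases h : x n ∈ conjMulConjInv (g n) ^ (N + 1)
      · have h' := h
        rw [pow_succ] at h'
        obtain ⟨y, hy, _, ⟨a, b, rfl⟩, hyx⟩ := h'
        exact ⟨y, a, b, fun _ => ⟨hy, hyx.symm⟩⟩
      · exact ⟨1, 1, 1, fun h' => absurd h' h⟩
    choose y a b hyab using this
    rw [𝒢.mk_eq_mk_of_eventually_eq U (h := y * (a * g * a⁻¹ * (b * g⁻¹ * b⁻¹)))
      (hx.mono fun n hn => (hyab n hn).2), pow_succ]
    exact ⟨_, ih (hx.mono fun n hn => (hyab n hn).1), _,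
      ⟨QuotientGroup.mk a, QuotientGroup.mk b, rfl⟩, rfl⟩

theorem eventually_lt_of_lt_qnorm {g : 𝒢.Q U} {r : ℝ≥0∞} (hg : r < 𝒢.qnorm U g) :
    ∀ᶠ n in U, r < 𝒢.ν n (Quotient.out g n) :=
  Ultrafilter.frequently_iff_eventually.1 (frequently_lt_of_lt_limsup (by isBoundedDefault) hg)

end PMFamily

theorem CN_subset_of_normal {G : Type*} [Group G] {H : Subgroup G} (hH : H.Normal) {g : G}
    (hg : g ∈ H) (N : ℕ) : CN N g ⊆ H := by
  have hsub : {x | IsConj g x} ∪ {x | IsConj g⁻¹ x} ⊆ (H : Set G) := by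
    rintro x (hx | hx) <;> obtain ⟨c, rfl⟩ := isConj_iff.1 hx
    exacts [hH.conj_mem _ hg c, hH.conj_mem _ (H.inv_mem hg) c]
  refine iUnion₂_subset fun k _ => ?_
  induction k with
  | zero => simp
  | succ k ih =>
    rw [pow_succ]
    rintro _ ⟨x, hx, y, hy, rfl⟩
    exact H.mul_mem (ih (by omega) hx) (hsub hy)

theorem SLFamily_exists_mem_CN {m : ℕ → ℕ} (hm : ∀ n, 2 ≤ m n) (U : Ultrafilter ℕ) {r : ℝ}
    (hr : 0 < r) : ∃ N : ℕ, ∀ g : ∀ n, (SLFamily m).G n,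
      (∀ᶠ n in U, ENNReal.ofReal r ≤ (SLFamily m).ν n (g n)) →
        ∀ x : (SLFamily m).Q U, x ∈ CN N (QuotientGroup.mk g : (SLFamily m).Q U) := by
  set q := max 2 ⌈4 / r⌉₊
  have hq : 4 ≤ ENNReal.ofReal r * q := by
    have h1 : 4 / r ≤ q := (Nat.le_ceil _).trans (Nat.cast_le.2 (le_max_right _ _))
    rw [div_le_iff₀' hr] at h1
    rw [← ENNReal.ofReal_natCast, ← ENNReal.ofReal_mul hr.le]
    simpa using ENNReal.ofReal_le_ofReal h1
  refine ⟨2 * (8 * q), fun g hg x => ?_⟩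
  obtain ⟨x, rfl⟩ := QuotientGroup.mk_surjective x
  refine conjMulConjInv_pow_subset_CN _ _ ((SLFamily m).mk_mem_conjMulConjInv_pow U
    (hg.mono fun n hn => ?_))
  have hmn : m n ≠ 0 := by have := hm n; omega
  exact mem_conjMulConjInv_pow_of_rank hmn (le_max_left _ _) _
    (mul_le_rank_of_le_jlen hmn hq hn) _

theorem SLFamily_nontrivial {m : ℕ → ℕ} (hm : ∀ n, 2 ≤ m n) (U : Ultrafilter ℕ) :
    Nontrivial ((SLFamily m).Q U) := by
  choose D z hz hD using fun n =>
    Matrix.SpecialLinearGroup.exists_injective_diagonal (m := m n) (by have := hm n; omega)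
  let g : ∀ n, (SLFamily m).G n := D
  refine ⟨QuotientGroup.mk g, 1, fun h => ?_⟩
  have hmem := ((SLFamily m).mem_E U).1 ((QuotientGroup.eq_one_iff _).1 h) 2⁻¹ (by simp)
  obtain ⟨n, hn⟩ := U.nonempty_of_mem hmem
  refine (lt_irrefl (2⁻¹ : ℝ≥0∞)) (lt_of_le_of_lt ?_ (mem_ofPred_eq ▸ hn))
  change 2⁻¹ ≤ jlen (m n) (D n : Matrix (Fin (m n)) (Fin (m n)) ℂ)
  rw [hD]
  exact half_le_jlen_diagonal (hm n) (hz n)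

/-- For a sequence `m_n ≥ 2`, any metric ultraproduct of the family
`(SL_{m_n}(ℂ), ℓ_J)` is a simple group; in fact it is metrically uniformly simple. -/
theorem statement19 (m : ℕ → ℕ) (hm : ∀ n, 2 ≤ m n)
    (U : Ultrafilter ℕ) (hU : (U : Filter ℕ) ≤ Filter.cofinite) :
    IsSimpleGroup ((SLFamily m).Q U) ∧
    (∀ t r : ℝ, 0 < r → r < t → ∃ N : ℕ, ∀ g : (SLFamily m).Q U,
      ENNReal.ofReal r < (SLFamily m).qnorm U g → (SLFamily m).qnorm U g ≤ ENNReal.ofReal t →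
        ∀ x : (SLFamily m).Q U, (SLFamily m).qnorm U x < ENNReal.ofReal t → x ∈ CN N g) := by
  refine ⟨?_, fun t r hr hrt => ?_⟩
  · have := SLFamily_nontrivial hm U
    refine ⟨fun H hH => or_iff_not_imp_left.2 fun hbot => ?_⟩
    obtain ⟨x, hxH, hx1⟩ := H.bot_or_exists_ne_one.resolve_left hbot
    obtain ⟨g, rfl⟩ := QuotientGroup.mk_surjective x
    rw [Ne, QuotientGroup.eq_one_iff, PMFamily.mem_E] at hx1
    push Not at hx1
    obtain ⟨ε, hε, hg⟩ := hx1
    have hg' : ∀ᶠ n in U, ENNReal.ofReal (min ε 1).toReal ≤ (SLFamily m).ν n (g n) := by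
      rw [ENNReal.ofReal_toReal (ne_top_of_le_ne_top ENNReal.one_ne_top (min_le_right _ _))]
      filter_upwards [Ultrafilter.compl_mem_iff_notMem.2 hg] with n hn
      exact (min_le_left _ _).trans (not_lt.1 hn)
    obtain ⟨N, hN⟩ := SLFamily_exists_mem_CN hm U (r := (min ε 1).toReal)
      (ENNReal.toReal_pos (lt_min hε one_pos).ne'
        (ne_top_of_le_ne_top ENNReal.one_ne_top (min_le_right _ _)))
    exact (Subgroup.eq_top_iff' H).2 fun x => CN_subset_of_normal hH hxH N (hN g hg' x)
  · obtain ⟨N, hN⟩ := SLFamily_exists_mem_CN hm U hr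
    refine ⟨N, fun g hg _ x _ => ?_⟩
    have := hN (Quotient.out g)
      (((SLFamily m).eventually_lt_of_lt_qnorm U hg).mono fun n hn => hn.le) x
    rwa [QuotientGroup.out_eq'] at this
end
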